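/- Composite i.i.d. null versus arbitrarily varying alternative. Let ℋ = ℂ^d be a finite-dimensional Hilbert space and 𝒜₁, ℬ₁ ⊆ 𝒟(ℋ) two non-empty closed sets of states. Then Stein(𝒜₁^{iid}‖ℬ₁^{av}) = Stein(𝒜₁^{iid}‖co(ℬ₁)^{av}) = Stein(𝒜₁^{iid}‖co(ℬ₁)^{iid}) = min*_{ρ∈𝒜₁, μ∈𝒫(co(ℬ₁))} lim_{n→∞} (1/n) D(ρ^{⊗n} ‖ ∫_{co(ℬ₁)} dμ(σ) σ^{⊗n}), where the minimum is restricted to those pairs (ρ,μ) for which the inner limit in n exists (a non-empty set on which the minimum is attained). -/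

import Mathlib

open Filter MeasureTheory Topology
open scoped BigOperators Classical ComplexOrder

noncomputable section

namespace QSanov

/-- Matrices representing operators on the single-copy Hilbert space with orthonormal
basis indexed by `ι`. -/
abbrev MatC (ι : Type*) := Matrix ι ι ℂ

/-- Matrices representing operators on the `n`-fold tensor power Hilbert space. -/
abbrev MatN (ι : Type*) (n : ℕ) := Matrix (Fin n → ι) (Fin n → ι) ℂ

instance matMeasurableSpace (m n : Type*) : MeasurableSpace (Matrix m n ℂ) :=
  inferInstanceAs (MeasurableSpace (m → n → ℂ))

/-- A quantum state: a positive semidefinite matrix of trace one. -/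
def IsState {κ : Type*} [Fintype κ] (ρ : Matrix κ κ ℂ) : Prop :=
  ρ.PosSemidef ∧ ρ.trace = 1

/-- Loewner order: `A ≤ B` iff `B - A` is positive semidefinite. -/
def loewnerLE {κ : Type*} [Fintype κ] (A B : Matrix κ κ ℂ) : Prop :=
  (B - A).PosSemidef

/-- The `n`-fold tensor power `ρ^{⊗n}` of a single-copy matrix. -/
def tensorPow {ι : Type*} (ρ : MatC ι) (n : ℕ) : MatN ι n :=
  fun i j => ∏ k, ρ (i k) (j k)

/-- The tensor product `ρ₁ ⊗ ⋯ ⊗ ρ_n` of a family of single-copy matrices. -/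
def tensorProdFam {ι : Type*} {n : ℕ} (ρ : Fin n → MatC ι) : MatN ι n :=
  fun i j => ∏ k, ρ k (i k) (j k)

/-- The tensor product of an `n`-copy matrix and an `m`-copy matrix. -/
def tensorMul {ι : Type*} {n m : ℕ} (ρ : MatN ι n) (σ : MatN ι m) : MatN ι (n + m) :=
  fun i j => ρ (fun t => i (Fin.castAdd m t)) (fun t => j (Fin.castAdd m t)) *
    σ (fun t => i (Fin.natAdd n t)) (fun t => j (Fin.natAdd n t))

/-- Conjugation `U_π ρ U_π†` by the unitary permuting the `n` tensor factors. -/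
def permCopies {ι : Type*} {n : ℕ} (π : Equiv.Perm (Fin n)) (ρ : MatN ι n) : MatN ι n :=
  fun i j => ρ (i ∘ π) (j ∘ π)

/-- Matrix logarithm via functional calculus on the support (eigenvalue `0` is sent
to `0`, since `Real.log 0 = 0`). -/
def matLog {κ : Type*} [Fintype κ] [DecidableEq κ] (A : Matrix κ κ ℂ) : Matrix κ κ ℂ :=
  if hA : A.IsHermitian then
    (hA.eigenvectorUnitary : Matrix κ κ ℂ) *
      (Matrix.diagonal fun i => (Real.log (hA.eigenvalues i) : ℂ)) *
      (star (hA.eigenvectorUnitary : Matrix κ κ ℂ))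
  else 0

/-- Support inclusion `supp ρ ⊆ supp σ`, phrased as inclusion of ranges. -/
def suppLE {κ : Type*} [Fintype κ] [DecidableEq κ] (ρ σ : Matrix κ κ ℂ) : Prop :=
  LinearMap.range (Matrix.toLin' ρ) ≤ LinearMap.range (Matrix.toLin' σ)

/-- Umegaki relative entropy `D(ρ‖σ) = Tr[ρ (log ρ - log σ)]`, equal to `+∞` when
`supp ρ ⊄ supp σ`. -/
def relEnt {κ : Type*} [Fintype κ] [DecidableEq κ] (ρ σ : Matrix κ κ ℂ) : EReal :=
  if suppLE ρ σ then (((ρ * (matLog ρ - matLog σ)).trace.re : ℝ) : EReal) else ⊤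

/-- Relative entropy between two sets of states: `D(𝒜‖ℬ) = inf_{ρ∈𝒜, σ∈ℬ} D(ρ‖σ)`. -/
def relEntSet {κ : Type*} [Fintype κ] [DecidableEq κ] (A B : Set (Matrix κ κ ℂ)) : EReal :=
  ⨅ ρ ∈ A, ⨅ σ ∈ B, relEnt ρ σ

/-- The composite i.i.d. hypothesis `𝒻₁^{⊗n, iid}` built on the base set `F1`. -/
def iidSet {ι : Type*} (F1 : Set (MatC ι)) (n : ℕ) : Set (MatN ι n) :=
  {ρ | ∃ σ ∈ F1, ρ = tensorPow σ n}

/-- The arbitrarily varying hypothesis `𝒻₁^{⊗n, av}` built on the base set `F1`. -/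
def avSet {ι : Type*} (F1 : Set (MatC ι)) (n : ℕ) : Set (MatN ι n) :=
  {ρ | ∃ f : Fin n → MatC ι, (∀ p, f p ∈ F1) ∧ ρ = tensorProdFam f}

/-- Worst-case type II error probability `β_ε(A‖B)` for a threshold `ε` on the
worst-case type I error probability. -/
def typeII {κ : Type*} [Fintype κ] [DecidableEq κ] (A B : Set (Matrix κ κ ℂ)) (ε : ℝ) : ℝ :=
  sInf {b : ℝ | ∃ E : Matrix κ κ ℂ, E.PosSemidef ∧ (1 - E).PosSemidef ∧
    (∀ ρ ∈ A, (ρ * (1 - E)).trace.re ≤ ε) ∧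
    b = sSup {x : ℝ | ∃ σ ∈ B, x = (σ * E).trace.re}}

/-- `- log x`, with value `+∞` for `x ≤ 0`. -/
def negLog (x : ℝ) : EReal := if x ≤ 0 then ⊤ else ((-Real.log x : ℝ) : EReal)

/-- `(1/n : EReal)`. -/
def cFrac (n : ℕ) : EReal := (((n : ℝ)⁻¹ : ℝ) : EReal)

/-- The Stein exponent `Stein(𝒜‖ℬ) = lim_{ε→0⁺} liminf_n -(1/n) log β_ε(𝒜_n‖ℬ_n)`;
since the inner quantity is monotone nondecreasing in `ε`, the limit as `ε → 0⁺`
coincides with the infimum over `ε ∈ (0,1)`. -/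
def steinExponent {ι : Type*} [Fintype ι] [DecidableEq ι]
    (A B : ∀ n : ℕ, Set (MatN ι n)) : EReal :=
  ⨅ ε ∈ Set.Ioo (0 : ℝ) 1,
    Filter.liminf (fun n : ℕ => cFrac n * negLog (typeII (A n) (B n) ε)) Filter.atTop

/-- The mixture `∫ dμ(σ) σ^{⊗n}` of i.i.d. states along a measure `μ` on a set of
states `C` (Bochner integral, computed entrywise). -/
def iidMix {ι : Type*} {C : Set (MatC ι)} (μ : Measure ↥C) (n : ℕ) : MatN ι n :=
  fun i j => ∫ σ, (∏ k, (σ : MatC ι) (i k) (j k)) ∂μ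

/-- The `b`-th block of size `k` of an index of `ℋ^{⊗ mk}`. -/
def blockOf {ι : Type*} {m k : ℕ} (i : Fin (m * k) → ι) (b : Fin m) : Fin k → ι :=
  fun t => i (finProdFinEquiv (b, t))

/-- Replace the blocks in `S` of the index `i` by the values prescribed by `c`. -/
def mergeBlocks {ι : Type*} {m k : ℕ} (S : Finset (Fin m)) (c : Fin m → Fin k → ι)
    (i : Fin (m * k) → ι) : Fin (m * k) → ι :=
  fun p => if (finProdFinEquiv.symm p).1 ∈ S
    then c (finProdFinEquiv.symm p).1 (finProdFinEquiv.symm p).2 else i p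

/-- Entry `(i,j)` of the partial trace of `ρ` over the blocks in `S`
(the remaining blocks being evaluated at `i`, `j`). -/
def blockPartialTrace {ι : Type*} [Fintype ι] {m k : ℕ} (S : Finset (Fin m))
    (ρ : MatN ι (m * k)) (i j : Fin (m * k) → ι) : ℂ :=
  (((Fintype.card ι : ℂ) ^ (k * (m - S.card)))⁻¹) *
    ∑ c : Fin m → Fin k → ι, ρ (mergeBlocks S c i) (mergeBlocks S c j)

/-- The `m`-fold tensor power `(𝒩^δ_ω)^{⊗ m}` of the depolarising channel
`𝒩^δ_ω(X) = (1-δ) X + δ Tr[X] ω`, acting blockwise on blocks of `k` tensor factors. -/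
def blockDepolarize {ι : Type*} [Fintype ι] (δ : ℝ) {k : ℕ} (ω : MatN ι k) (m : ℕ)
    (ρ : MatN ι (m * k)) : MatN ι (m * k) :=
  fun i j => ∑ S : Finset (Fin m),
    (((1 - δ) ^ (m - S.card) * δ ^ S.card : ℝ) : ℂ) *
      ((∏ b ∈ S, ω (blockOf i b) (blockOf j b)) * blockPartialTrace S ρ i j)

/-- The `m`-fold tensor power of a `k`-copy matrix, as an `mk`-copy matrix. -/
def powBlocks {ι : Type*} {k : ℕ} (ρ : MatN ι k) (m : ℕ) : MatN ι (m * k) :=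
  fun i j => ∏ b : Fin m, ρ (blockOf i b) (blockOf j b)

/-- `Tr_{n+1,…,n+k}[ρ (𝟙^{⊗n} ⊗ F)]`, the filtered reduction of an `(n+k)`-copy matrix. -/
def condReduce {ι : Type*} [Fintype ι] {n k : ℕ} (ρ : MatN ι (n + k)) (F : MatN ι k) :
    MatN ι n :=
  fun i j => ∑ a : Fin k → ι, ∑ b : Fin k → ι,
    ρ (Fin.append i a) (Fin.append j b) * F b a

/-- Partial trace over the `k`-th tensor factor. -/
def traceOutAt {ι : Type*} [Fintype ι] {n : ℕ} (k : Fin (n + 1)) (σ : MatN ι (n + 1)) :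
    MatN ι n :=
  fun i j => ∑ a : ι, σ (k.insertNth a i) (k.insertNth a j)

/-- Insert the single-copy state `τ` at position `k` into an `n`-copy matrix. -/
def insertState {ι : Type*} {n : ℕ} (k : Fin (n + 1)) (τ : MatC ι) (σ : MatN ι n) :
    MatN ι (n + 1) :=
  fun i j => τ (i k) (j k) *
    σ (fun t => i (k.succAbove t)) (fun t => j (k.succAbove t))

/-- Product of a state on `A^n` and a state on `B^n`, viewed as a state on
`(ℋ_A ⊗ ℋ_B)^{⊗ n}` (reordering tensor factors implicitly). -/
def prodStateAB {ιA ιB : Type*} {n : ℕ} (α : Matrix (Fin n → ιA) (Fin n → ιA) ℂ)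
    (β : Matrix (Fin n → ιB) (Fin n → ιB) ℂ) : MatN (ιA × ιB) n :=
  fun i j => α (fun k => (i k).1) (fun k => (j k).1) * β (fun k => (i k).2) (fun k => (j k).2)


/-- The set `𝒮_{A^n:B^n}` of separable states across the cut `A^n : B^n`. -/
def sepSet (ιA ιB : Type*) [Fintype ιA] [Fintype ιB] (n : ℕ) : Set (MatN (ιA × ιB) n) :=
  convexHull ℝ {ρ | ∃ α β, IsState α ∧ IsState β ∧ ρ = prodStateAB α β}

/-- Classical relative entropy of two finitely supported output distributions. -/
def clRelEnt {m : ℕ} (P Q : Fin m → ℝ) : EReal :=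
  ∑ x, (if P x = 0 then (0 : EReal) else if Q x = 0 then (⊤ : EReal)
    else ((P x * Real.log (P x / Q x) : ℝ) : EReal))

/-- Measured relative entropy: supremum over all finite POVMs of the classical
relative entropy of the induced outcome distributions. -/
def measuredRelEnt {κ : Type*} [Fintype κ] [DecidableEq κ] (ρ σ : Matrix κ κ ℂ) : EReal :=
  ⨆ (m : ℕ) (E : Fin m → Matrix κ κ ℂ) (_ : ∀ x, (E x).PosSemidef) (_ : ∑ x, E x = 1),
    clRelEnt (fun x => (ρ * E x).trace.re) (fun x => (σ * E x).trace.re)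


/-- Axiom Q.I: there is a full-support free state `τ ∈ 𝒜₁` such that every `𝒜_{mk}`
is stable under blockwise depolarising towards `τ^{⊗k}`. -/
def AxiomQI {ι : Type*} [Fintype ι] [DecidableEq ι] (A : ∀ n : ℕ, Set (MatN ι n)) : Prop :=
  ∃ τ : MatC ι, tensorPow τ 1 ∈ A 1 ∧
    ∀ m k : ℕ, 1 ≤ m → 1 ≤ k → ∀ ρ ∈ A (m * k),
      suppLE ρ (tensorPow τ (m * k)) ∧
      ∀ δ ∈ Set.Icc (0 : ℝ) 1, blockDepolarize δ (tensorPow τ k) m ρ ∈ A (m * k)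

/-- Axiom Q.II: closedness under tensor powers. -/
def AxiomQII {ι : Type*} (A : ∀ n : ℕ, Set (MatN ι n)) : Prop :=
  ∀ m k : ℕ, 1 ≤ m → 1 ≤ k → ∀ ρ ∈ A k, powBlocks ρ m ∈ A (m * k)

/-- Axiom Q.III: closedness under permutations of the tensor factors. -/
def AxiomQIII {ι : Type*} (A : ∀ n : ℕ, Set (MatN ι n)) : Prop :=
  ∀ n : ℕ, ∀ ρ ∈ A n, ∀ π : Equiv.Perm (Fin n), permCopies π ρ ∈ A n

/-- Axiom Q.IV: filtering by Hermitian operators in a neighbourhood of the identity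
is completely `cone(𝒜)`-preserving. -/
def AxiomQIV {ι : Type*} [Fintype ι] [DecidableEq ι] (A : ∀ n : ℕ, Set (MatN ι n)) : Prop :=
  ∀ k : ℕ, 1 ≤ k →
    ∃ V : Set (MatN ι k), V ∈ nhds (1 : MatN ι k) ∧
      ∀ F ∈ V, F.IsHermitian → ∀ n : ℕ, 1 ≤ n → ∀ ρ ∈ A (n + k),
        ∃ (lam : ℝ) (ω : MatN ι n), 0 ≤ lam ∧ ω ∈ A n ∧ condReduce ρ F = (lam : ℂ) • ω

section MatrixBasics

open scoped MatrixOrder Matrix.Norms.L2Operator NNReal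

variable {κ : Type*} [Fintype κ]

/-- The real bilinear form `(A, B) ↦ Re Tr[A B]`. -/
def hsForm : Matrix κ κ ℂ →ₗ[ℝ] Matrix κ κ ℂ →ₗ[ℝ] ℝ :=
  LinearMap.mk₂ ℝ (fun A B => (A * B).trace.re)
    (fun A A' B => by simp [add_mul])
    (fun c A B => by simp [Matrix.trace_smul])
    (fun A B B' => by simp [mul_add])
    (fun c A B => by simp [Matrix.trace_smul])

lemma hsForm_apply (A B : Matrix κ κ ℂ) : hsForm A B = (A * B).trace.re := rfl

lemma hsForm_comm (A B : Matrix κ κ ℂ) : hsForm A B = hsForm B A := by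
  rw [hsForm_apply, hsForm_apply, Matrix.trace_mul_comm]

lemma hsForm_nonneg {A B : Matrix κ κ ℂ} (hA : 0 ≤ A) (hB : 0 ≤ B) : 0 ≤ hsForm A B := by
  obtain ⟨C, rfl⟩ := CStarAlgebra.nonneg_iff_eq_star_mul_self.mp hA
  rw [hsForm_apply, mul_assoc, Matrix.trace_mul_comm, mul_assoc, ← mul_assoc]
  have h := ((Matrix.nonneg_iff_posSemidef.mp hB).mul_mul_conjTranspose_same C).trace_nonneg
  exact (Complex.le_def.mp h).1

lemma hsForm_mono_left {A A' B : Matrix κ κ ℂ} (h : A ≤ A') (hB : 0 ≤ B) :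
    hsForm A B ≤ hsForm A' B := by
  have := hsForm_nonneg (sub_nonneg.mpr h) hB
  rw [map_sub, LinearMap.sub_apply] at this
  linarith

lemma hsForm_mono_right {A B B' : Matrix κ κ ℂ} (hA : 0 ≤ A) (h : B ≤ B') :
    hsForm A B ≤ hsForm A B' := by
  rw [hsForm_comm A, hsForm_comm A]
  exact hsForm_mono_left h hA

lemma hsForm_one_right [DecidableEq κ] (A : Matrix κ κ ℂ) : hsForm A 1 = A.trace.re := by
  rw [hsForm_apply, mul_one]

lemma IsState.nonneg {ρ : Matrix κ κ ℂ} (h : IsState ρ) : 0 ≤ ρ :=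
  Matrix.nonneg_iff_posSemidef.mpr h.1

lemma IsState.hsForm_one [DecidableEq κ] {ρ : Matrix κ κ ℂ} (h : IsState ρ) :
    hsForm ρ 1 = 1 := by
  rw [hsForm_one_right, h.2, Complex.one_re]

lemma hsForm_le_one [DecidableEq κ] {ρ E : Matrix κ κ ℂ} (h : IsState ρ) (hE : E ≤ 1) :
    hsForm ρ E ≤ 1 :=
  (hsForm_mono_right h.nonneg hE).trans_eq h.hsForm_one

lemma continuousOn_spectrum [DecidableEq κ] (f : ℝ → ℝ) (H : Matrix κ κ ℂ) :
    ContinuousOn f (spectrum ℝ H) :=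
  (Matrix.finite_real_spectrum (A := H)).continuousOn f

/-- The quantum Chernoff bound of Audenaert et al.: the Neyman–Pearson test achieves
the error `Tr[A^{1-s} B^s]`. -/
lemma exists_test_le_nnrpow [DecidableEq κ] {A B : Matrix κ κ ℂ} (hA : 0 ≤ A) (hB : 0 ≤ B)
    {s t : ℝ≥0} (hs : 0 < s) (ht : 0 < t) (hst : t + s = 1) :
    ∃ E : Matrix κ κ ℂ, 0 ≤ E ∧ E ≤ 1 ∧
      hsForm A (1 - E) + hsForm B E ≤ hsForm (A ^ t) (B ^ s) := by
  have hs1 : s ∈ Set.Icc (0 : ℝ≥0) 1 := ⟨hs.le, hst ▸ le_add_self⟩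
  have ht1 : t ∈ Set.Icc (0 : ℝ≥0) 1 := ⟨ht.le, hst ▸ le_self_add⟩
  have hH : IsSelfAdjoint (A - B) := (IsSelfAdjoint.of_nonneg hA).sub (.of_nonneg hB)
  set H := A - B with hHdef
  set E := cfc (fun x : ℝ => if 0 < x then (1 : ℝ) else 0) H with hE
  set P := cfc (fun x : ℝ => max x 0) H with hP
  have hcont := fun f : ℝ → ℝ => continuousOn_spectrum f H
  have hP0 : 0 ≤ P := cfc_nonneg fun x _ => le_max_right _ _
  have hHP : H ≤ P := by
    conv_lhs => rw [← cfc_id ℝ H]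
    exact cfc_mono (fun x _ => le_max_left _ _) (hcont _) (hcont _)
  have hHE : H * E = P := by
    conv_lhs => rw [← cfc_id ℝ H, hE, ← cfc_mul _ _ H (hcont _) (hcont _)]
    refine cfc_congr fun x _ => ?_
    by_cases hx : 0 < x
    · simp [hx, hx.le]
    · simp [hx, not_lt.mp hx]
  refine ⟨E, cfc_nonneg fun x _ => by split_ifs <;> simp, cfc_le_one _ _ fun x _ => by
    split_ifs <;> simp, ?_⟩
  have h1 : hsForm A (1 - E) + hsForm B E = hsForm A 1 - hsForm P 1 := by
    have : hsForm H E = hsForm P 1 := by rw [hsForm_apply, hHE, hsForm_one_right]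
    rw [← this, hHdef]
    simp only [map_sub, LinearMap.sub_apply]
    ring
  have hX1 : A ≤ B + P := by
    have := add_le_add_right hHP B
    simpa [hHdef] using this
  have hX2 : B ≤ B + P := le_add_of_nonneg_right hP0
  have hX : 0 ≤ B + P := hB.trans hX2
  have key : ∀ {Y : Matrix κ κ ℂ}, 0 ≤ Y → hsForm (Y ^ t) (Y ^ s) = hsForm Y 1 := by
    intro Y hY
    rw [hsForm_apply, ← CFC.nnrpow_add ht hs, hst, CFC.nnrpow_one Y hY, hsForm_one_right]
  have hAs : A ^ s ≤ (B + P) ^ s := CFC.nnrpow_le_nnrpow hs1 hX1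
  have hAt : A ^ t ≤ (B + P) ^ t := CFC.nnrpow_le_nnrpow ht1 hX1
  have hBs : B ^ s ≤ (B + P) ^ s := CFC.nnrpow_le_nnrpow hs1 hX2
  have hBt : B ^ t ≤ (B + P) ^ t := CFC.nnrpow_le_nnrpow ht1 hX2
  have hAt0 : 0 ≤ A ^ t := CFC.nnrpow_nonneg
  have hBs0 : 0 ≤ B ^ s := CFC.nnrpow_nonneg
  have h2 : hsForm A 1 - hsForm (A ^ t) (B ^ s) ≤
      hsForm (B + P) 1 - hsForm ((B + P) ^ t) (B ^ s) := by
    rw [← key hA, ← key hX, ← map_sub, ← map_sub]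
    exact (hsForm_mono_right hAt0 (sub_le_sub_right hAs _)).trans
      (hsForm_mono_left hAt (sub_nonneg.mpr hBs))
  have h3 : hsForm B 1 ≤ hsForm ((B + P) ^ t) (B ^ s) := by
    rw [← key hB]
    exact hsForm_mono_left hBt hBs0
  rw [map_add, LinearMap.add_apply] at h2
  linarith

/-- Combining finitely many tests by `E = T (T + η)⁻¹` with `T = ∑ E_j`. -/
lemma exists_union_test [DecidableEq κ] {J : Type*} (t : Finset J) (E : J → Matrix κ κ ℂ)
    (hE0 : ∀ j ∈ t, 0 ≤ E j) (hE1 : ∀ j ∈ t, E j ≤ 1) {η : ℝ} (hη : 0 < η) :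
    ∃ F : Matrix κ κ ℂ, 0 ≤ F ∧ F ≤ 1 ∧
      (∀ j ∈ t, 1 - F ≤ (1 - E j) + algebraMap ℝ _ η) ∧ F ≤ η⁻¹ • ∑ j ∈ t, E j := by
  have hT0 : 0 ≤ ∑ j ∈ t, E j := Finset.sum_nonneg hE0
  have hTE : ∀ j ∈ t, E j ≤ ∑ j ∈ t, E j := fun j hj => Finset.single_le_sum hE0 hj
  set T := ∑ j ∈ t, E j
  have hcont := fun (f : ℝ → ℝ) (H : Matrix κ κ ℂ) => continuousOn_spectrum f H
  have hunit : ∀ {X : Matrix κ κ ℂ}, 0 ≤ X →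
      (X + algebraMap ℝ _ η) * cfc (fun x : ℝ => (x + η)⁻¹) X = 1 := by
    intro X hX
    have hsa : IsSelfAdjoint X := .of_nonneg hX
    have h1 : X + algebraMap ℝ _ η = cfc (fun x : ℝ => x + η) X := by
      rw [cfc_add X _ _ (hcont _ _) (hcont _ _), cfc_id' ℝ X, cfc_const η X]
    rw [h1, ← cfc_mul _ _ X (hcont _ _) (hcont _ _), ← cfc_const_one ℝ X]
    refine cfc_congr fun x hx => ?_
    have : 0 ≤ x := spectrum_nonneg_of_nonneg hX hx
    exact mul_inv_cancel₀ (by positivity)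
  have hunit' : ∀ {X : Matrix κ κ ℂ}, 0 ≤ X →
      cfc (fun x : ℝ => (x + η)⁻¹) X * (X + algebraMap ℝ _ η) = 1 := by
    intro X hX
    rw [mul_eq_one_comm]
    exact hunit hX
  have hanti : ∀ {X Y : Matrix κ κ ℂ}, 0 ≤ X → X ≤ Y →
      cfc (fun x : ℝ => (x + η)⁻¹) Y ≤ cfc (fun x : ℝ => (x + η)⁻¹) X := by
    intro X Y hX hXY
    have hY := hX.trans hXY
    have h := CStarAlgebra.inv_le_inv
      (a := ⟨X + algebraMap ℝ _ η, cfc (fun x : ℝ => (x + η)⁻¹) X, hunit hX, hunit' hX⟩)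
      (b := ⟨Y + algebraMap ℝ _ η, cfc (fun x : ℝ => (x + η)⁻¹) Y, hunit hY, hunit' hY⟩)
      (add_nonneg hX (algebraMap_nonneg _ hη.le)) (add_le_add_left hXY _)
    exact h
  have hsa : IsSelfAdjoint T := .of_nonneg hT0
  refine ⟨cfc (fun x : ℝ => x / (x + η)) T, cfc_nonneg fun x hx => ?_,
    cfc_le_one _ _ fun x hx => ?_, fun j hj => ?_, ?_⟩
  · have : 0 ≤ x := spectrum_nonneg_of_nonneg hT0 hx
    positivity
  · have : 0 ≤ x := spectrum_nonneg_of_nonneg hT0 hx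
    rw [div_le_one (by positivity)]
    linarith
  · have hsaj : IsSelfAdjoint (E j) := .of_nonneg (hE0 j hj)
    have h1 : 1 - cfc (fun x : ℝ => x / (x + η)) T = η • cfc (fun x : ℝ => (x + η)⁻¹) T := by
      rw [← cfc_const_one ℝ T, ← cfc_sub _ _ T (hcont _ _) (hcont _ _),
        ← cfc_smul η _ T (hcont _ _)]
      refine cfc_congr fun x hx => ?_
      have : 0 ≤ x := spectrum_nonneg_of_nonneg hT0 hx
      have : x + η ≠ 0 := by positivity
      simp only [smul_eq_mul]
      field_simp
      ring
    have h2 : (1 - E j) + algebraMap ℝ _ η = cfc (fun x : ℝ => 1 - x + η) (E j) := by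
      rw [cfc_add (E j) _ _ (hcont _ _) (hcont _ _), cfc_sub _ _ (E j) (hcont _ _) (hcont _ _),
        cfc_id' ℝ (E j), cfc_const η (E j), cfc_const_one ℝ (E j)]
    rw [h1, h2]
    refine (smul_le_smul_of_nonneg_left (hanti (hE0 j hj) (hTE j hj)) hη.le).trans ?_
    rw [← cfc_smul η _ (E j) (hcont _ _)]
    refine cfc_mono (fun x hx => ?_) (hcont _ _) (hcont _ _)
    have hx0 : 0 ≤ x := spectrum_nonneg_of_nonneg (hE0 j hj) hx
    have hx1 : x ≤ 1 := by
      have := (cfc_le_one_iff (fun x : ℝ => x) (E j) (hcont _ _)).mp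
        (by rw [cfc_id' ℝ (E j)]; exact hE1 j hj) x hx
      exact this
    simp only [smul_eq_mul]
    rw [← div_eq_mul_inv, div_le_iff₀ (by positivity)]
    nlinarith
  · have h1 : η⁻¹ • T = cfc (fun x : ℝ => η⁻¹ * x) T := by
      rw [cfc_const_mul η⁻¹ _ T (hcont _ _), cfc_id' ℝ T]
    rw [h1]
    refine cfc_mono (fun x hx => ?_) (hcont _ _) (hcont _ _)
    have hx0 : 0 ≤ x := spectrum_nonneg_of_nonneg hT0 hx
    rw [div_eq_mul_inv, mul_comm]
    gcongr
    linarith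

end MatrixBasics

section Classical

variable {Ω : Type*} [Fintype Ω] {P Q : Ω → ℝ}

lemma sub_le_mul_log_sub {p q : ℝ} (hp : 0 ≤ p) (hq : 0 ≤ q) (hac : q = 0 → p = 0) :
    p - q ≤ p * (Real.log p - Real.log q) := by
  rcases hp.eq_or_lt with rfl | hp
  · simpa using hq
  · have hq' : 0 < q := hq.lt_of_ne fun h => hp.ne' (hac h.symm)
    have h := Real.one_sub_inv_le_log_of_pos (div_pos hp hq')
    rw [Real.log_div hp.ne' hq'.ne', inv_div] at h
    have h2 := mul_le_mul_of_nonneg_left h hp.le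
    have h3 : p * (1 - q / p) = p - q := by field_simp
    linarith

/-- A Markov-type bound on the overlap of two distributions through their relative entropy. -/
lemma one_sub_le_sum_min (hP : ∀ x, 0 ≤ P x) (hQ : ∀ x, 0 ≤ Q x) (hPs : ∑ x, P x = 1)
    (hQs : ∑ x, Q x = 1) (hac : ∀ x, Q x = 0 → P x = 0) {a : ℝ} (ha : 0 < a) :
    1 - (∑ x, P x * (Real.log (P x) - Real.log (Q x)) + 1) / a
      ≤ ∑ x, min (P x) (Real.exp a * Q x) := by
  have hpt : ∀ x, P x - min (P x) (Real.exp a * Q x)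
      ≤ (P x * (Real.log (P x) - Real.log (Q x)) + Q x) / a := by
    intro x
    have h1 := sub_le_mul_log_sub (hP x) (hQ x) (hac x)
    rcases le_or_gt (P x) (Real.exp a * Q x) with h | h
    · rw [min_eq_left h, sub_self]
      have := hP x
      exact div_nonneg (by linarith) ha.le
    · rw [min_eq_right h.le]
      have hp : 0 < P x := (mul_nonneg (Real.exp_pos a).le (hQ x)).trans_lt h
      have hq : 0 < Q x := (hQ x).lt_of_ne fun h0 => hp.ne' (hac x h0.symm)
      have hl := Real.log_lt_log (by positivity) h
      rw [Real.log_mul (Real.exp_pos a).ne' hq.ne', Real.log_exp] at hl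
      rw [le_div_iff₀ ha]
      have : P x * a ≤ P x * (Real.log (P x) - Real.log (Q x)) :=
        mul_le_mul_of_nonneg_left (by linarith) hp.le
      have : 0 ≤ Real.exp a * Q x * a := by positivity
      nlinarith
  have := Finset.sum_le_sum fun x (_ : x ∈ Finset.univ) => hpt x
  rw [Finset.sum_sub_distrib, ← Finset.sum_div, Finset.sum_add_distrib, hPs, hQs] at this
  linarith

lemma sum_mul_log_sub_nonneg (hP : ∀ x, 0 ≤ P x) (hQ : ∀ x, 0 ≤ Q x) (hPs : ∑ x, P x = 1)
    (hQs : ∑ x, Q x = 1) (hac : ∀ x, Q x = 0 → P x = 0) :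
    0 ≤ ∑ x, P x * (Real.log (P x) - Real.log (Q x)) := by
  have := Finset.sum_le_sum fun x (_ : x ∈ Finset.univ) =>
    sub_le_mul_log_sub (hP x) (hQ x) (hac x)
  rw [Finset.sum_sub_distrib, hPs, hQs, sub_self] at this
  exact this

/-- If `b` is below the relative entropy (or absolute continuity fails), then
`e^{s b} ∑ P^{1-s} Q^s < 1` for all small `s > 0`. -/
lemma eventually_exp_mul_sum_rpow_lt_one (hP : ∀ x, 0 ≤ P x) (hQ : ∀ x, 0 ≤ Q x)
    (hPs : ∑ x, P x = 1) {b : ℝ}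
    (hb : (∀ x, Q x = 0 → P x = 0) → b < ∑ x, P x * (Real.log (P x) - Real.log (Q x))) :
    ∀ᶠ s : ℝ in 𝓝[>] 0, Real.exp (s * b) * ∑ x, P x ^ (1 - s) * Q x ^ s < 1 := by
  set c : Ω → ℝ := fun x => b + Real.log (Q x) - Real.log (P x)
  set h : ℝ → ℝ := fun s => ∑ x, if Q x = 0 then 0 else P x * Real.exp (s * c x) with hh
  have hd : HasDerivAt h (∑ x, if Q x = 0 then 0 else P x * c x) 0 := by
    refine HasDerivAt.fun_sum fun x _ => ?_
    split_ifs
    · exact hasDerivAt_const _ _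
    · have := ((hasDerivAt_mul_const (c x) (x := (0 : ℝ))).exp).const_mul (P x)
      simpa using this
  have heq : ∀ᶠ s : ℝ in 𝓝[>] 0, Real.exp (s * b) * ∑ x, P x ^ (1 - s) * Q x ^ s = h s := by
    filter_upwards [Ioo_mem_nhdsGT (zero_lt_one (α := ℝ))] with s hs
    rw [hh, Finset.mul_sum]
    refine Finset.sum_congr rfl fun x _ => ?_
    split_ifs with hq
    · rw [hq, Real.zero_rpow hs.1.ne']; simp
    · rcases (hP x).eq_or_lt with hp | hp
      · rw [← hp, Real.zero_rpow (by linarith [hs.2])]; simp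
      · have hq' : 0 < Q x := (hQ x).lt_of_ne' hq
        rw [Real.rpow_def_of_pos hp, Real.rpow_def_of_pos hq', ← Real.exp_add, ← Real.exp_add]
        conv_rhs => rw [← Real.exp_log hp, ← Real.exp_add]
        congr 1
        simp only [c]
        ring
  suffices hs : ∀ᶠ s : ℝ in 𝓝[>] 0, h s < 1 by
    filter_upwards [heq, hs] with s h1 h2
    rwa [h1]
  have h0 : h 0 = ∑ x, if Q x = 0 then 0 else P x := by simp [hh]
  by_cases hac : ∀ x, Q x = 0 → P x = 0
  · have h01 : h 0 = 1 := by
      rw [h0, ← hPs]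
      refine Finset.sum_congr rfl fun x _ => ?_
      split_ifs with hq
      · exact (hac x hq).symm
      · rfl
    have hneg : (∑ x, if Q x = 0 then 0 else P x * c x) < 0 := by
      have : (∑ x, if Q x = 0 then 0 else P x * c x)
          = b - ∑ x, P x * (Real.log (P x) - Real.log (Q x)) := by
        rw [← mul_one b, ← hPs, Finset.mul_sum, ← Finset.sum_sub_distrib]
        refine Finset.sum_congr rfl fun x _ => ?_
        split_ifs with hq
        · simp [hac x hq]
        · simp only [c]; ring
      rw [this]
      linarith [hb hac]
    have ht := (hasDerivAt_iff_tendsto_slope.mp hd).mono_left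
      (nhdsWithin_mono 0 (fun s (hs : 0 < s) => hs.ne' : Set.Ioi (0 : ℝ) ⊆ {0}ᶜ))
    filter_upwards [ht.eventually_lt_const hneg, self_mem_nhdsWithin] with s hs hs0
    have hs0 : 0 < s := hs0
    rw [slope_def_field, h01, sub_zero, div_lt_iff₀ hs0] at hs
    linarith
  · push Not at hac
    obtain ⟨x, hx, hx'⟩ := hac
    have h01 : h 0 < 1 := by
      rw [h0, ← hPs]
      refine Finset.sum_lt_sum (fun y _ => ?_) ⟨x, Finset.mem_univ _, ?_⟩
      · split_ifs
        · exact hP y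
        · exact le_rfl
      · rw [if_pos hx]; exact (hP x).lt_of_ne' hx'
    exact (hd.continuousAt.eventually_lt_const h01).filter_mono nhdsWithin_le_nhds

end Classical

section NussbaumSzkola

open scoped MatrixOrder Matrix.Norms.L2Operator NNReal Matrix

variable {κ : Type*} [Fintype κ] [DecidableEq κ] {A B : Matrix κ κ ℂ}

/-- The overlaps `|⟨v_j|u_i⟩|²` between eigenbases of two Hermitian matrices. -/
def eigenOverlap (hA : A.IsHermitian) (hB : B.IsHermitian) (p : κ × κ) : ℝ :=
  Complex.normSq (((hB.eigenvectorUnitary : Matrix κ κ ℂ)ᴴ *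
    (hA.eigenvectorUnitary : Matrix κ κ ℂ)) p.2 p.1)

lemma trace_diagonal_conj (f g : κ → ℝ) (X : Matrix κ κ ℂ) :
    (Matrix.diagonal (fun i => (f i : ℂ)) * Xᴴ * Matrix.diagonal (fun j => (g j : ℂ)) * X).trace.re
      = ∑ p : κ × κ, f p.1 * g p.2 * Complex.normSq (X p.2 p.1) := by
  rw [Fintype.sum_prod_type, Matrix.trace, Complex.re_sum]
  refine Finset.sum_congr rfl fun i _ => ?_
  rw [Matrix.diag_apply, Matrix.mul_apply, Complex.re_sum]
  refine Finset.sum_congr rfl fun j _ => ?_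
  rw [Matrix.mul_diagonal, Matrix.diagonal_mul, Matrix.conjTranspose_apply]
  have : (f i : ℂ) * star (X j i) * (g j : ℂ) * X j i
      = ((f i * g j * Complex.normSq (X j i) : ℝ) : ℂ) := by
    push_cast
    rw [Complex.normSq_eq_conj_mul_self]
    simp only [RCLike.star_def]
    ring
  rw [this, Complex.ofReal_re]

lemma cfc_eq_mul_diagonal_mul (hA : A.IsHermitian) (f : ℝ → ℝ) :
    cfc f A = (hA.eigenvectorUnitary : Matrix κ κ ℂ) *
      Matrix.diagonal (fun i => (f (hA.eigenvalues i) : ℂ)) *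
      (hA.eigenvectorUnitary : Matrix κ κ ℂ)ᴴ := by
  rw [hA.cfc_eq, Matrix.IsHermitian.cfc, Unitary.conjStarAlgAut_apply]
  rfl

lemma eigenvectorUnitary_conj_mul (hA : A.IsHermitian) :
    (hA.eigenvectorUnitary : Matrix κ κ ℂ)ᴴ * (hA.eigenvectorUnitary : Matrix κ κ ℂ) = 1 :=
  Unitary.coe_star_mul_self _

lemma eigenvectorUnitary_mul_conj (hA : A.IsHermitian) :
    (hA.eigenvectorUnitary : Matrix κ κ ℂ) * (hA.eigenvectorUnitary : Matrix κ κ ℂ)ᴴ = 1 :=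
  Unitary.coe_mul_star_self _

lemma hsForm_cfc_cfc (hA : A.IsHermitian) (hB : B.IsHermitian) (f g : ℝ → ℝ) :
    hsForm (cfc f A) (cfc g B) = ∑ p : κ × κ, f (hA.eigenvalues p.1) * g (hB.eigenvalues p.2) *
      eigenOverlap hA hB p := by
  rw [hsForm_apply, cfc_eq_mul_diagonal_mul hA, cfc_eq_mul_diagonal_mul hB]
  refine Eq.trans ?_ (trace_diagonal_conj (fun i => f (hA.eigenvalues i))
    (fun j => g (hB.eigenvalues j)) _)
  rw [Matrix.mul_assoc, Matrix.mul_assoc, Matrix.trace_mul_comm]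
  simp only [Matrix.conjTranspose_mul, Matrix.conjTranspose_conjTranspose, Matrix.mul_assoc]

lemma cfc_id_of_isHermitian (hA : A.IsHermitian) : cfc (id : ℝ → ℝ) A = A :=
  cfc_id ℝ A hA.isSelfAdjoint

lemma cfc_one_of_isHermitian (hA : A.IsHermitian) : cfc (1 : ℝ → ℝ) A = 1 :=
  cfc_one ℝ A hA.isSelfAdjoint

lemma eq_mul_diagonal_mul (hA : A.IsHermitian) : A = (hA.eigenvectorUnitary : Matrix κ κ ℂ) *
      Matrix.diagonal (fun i => (hA.eigenvalues i : ℂ)) *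
      (hA.eigenvectorUnitary : Matrix κ κ ℂ)ᴴ :=
  (cfc_id_of_isHermitian hA).symm.trans (cfc_eq_mul_diagonal_mul hA id)

lemma hsForm_sq (hA : A.IsHermitian) (hB : B.IsHermitian) {F : Matrix κ κ ℂ}
    (hF : F.IsHermitian) : hsForm A (F * F) = ∑ p : κ × κ, hA.eigenvalues p.1 *
      Complex.normSq (((hB.eigenvectorUnitary : Matrix κ κ ℂ)ᴴ * F *
        (hA.eigenvectorUnitary : Matrix κ κ ℂ)) p.2 p.1) := by
  have h := trace_diagonal_conj hA.eigenvalues (fun _ => 1)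
    ((hB.eigenvectorUnitary : Matrix κ κ ℂ)ᴴ * F * (hA.eigenvectorUnitary : Matrix κ κ ℂ))
  simp only [mul_one] at h
  rw [← h, hsForm_apply]
  rw [congrArg (fun M => (M * (F * F)).trace.re) (eq_mul_diagonal_mul hA)]
  rw [Matrix.mul_assoc, Matrix.mul_assoc, Matrix.trace_mul_comm]
  have hone : Matrix.diagonal (fun _ : κ => ((1 : ℝ) : ℂ)) = 1 := by simp
  rw [hone]
  simp only [Matrix.conjTranspose_mul, Matrix.conjTranspose_conjTranspose, Matrix.mul_assoc,
    Matrix.one_mul, hF.eq]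
  rw [← Matrix.mul_assoc (hB.eigenvectorUnitary : Matrix κ κ ℂ), eigenvectorUnitary_mul_conj,
    Matrix.one_mul]

lemma eigenOverlap_nonneg (hA : A.IsHermitian) (hB : B.IsHermitian) (p : κ × κ) :
    0 ≤ eigenOverlap hA hB p := Complex.normSq_nonneg _

lemma matLog_eq_cfc (hA : A.IsHermitian) : matLog A = cfc Real.log A := by
  rw [matLog, dif_pos hA, cfc_eq_mul_diagonal_mul hA]
  rfl

lemma suppLE_iff (hA : A.IsHermitian) (hB : B.IsHermitian) : suppLE A B ↔
    ∀ p : κ × κ, hB.eigenvalues p.2 = 0 → hA.eigenvalues p.1 * eigenOverlap hA hB p = 0 := by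
  set U := (hA.eigenvectorUnitary : Matrix κ κ ℂ) with hU
  set V := (hB.eigenvectorUnitary : Matrix κ κ ℂ) with hV
  have hAd : A = U * Matrix.diagonal (fun i => (hA.eigenvalues i : ℂ)) * Uᴴ :=
    eq_mul_diagonal_mul hA
  have hBd : B = V * Matrix.diagonal (fun i => (hB.eigenvalues i : ℂ)) * Vᴴ :=
    eq_mul_diagonal_mul hB
  have hUU := eigenvectorUnitary_conj_mul hA
  have hVV := eigenvectorUnitary_conj_mul hB
  have hVV' := eigenvectorUnitary_mul_conj hB
  rw [← hU] at hUU
  rw [← hV] at hVV hVV'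
  have hentry : ∀ p : κ × κ, (hA.eigenvalues p.1 * eigenOverlap hA hB p = 0 ↔
      (Vᴴ * A * U) p.2 p.1 = 0) := by
    intro p
    have : Vᴴ * A * U = (Vᴴ * U) * Matrix.diagonal (fun i => (hA.eigenvalues i : ℂ)) := by
      conv_lhs => rw [hAd]
      simp only [Matrix.mul_assoc, hUU, Matrix.mul_one]
    rw [this, Matrix.mul_diagonal, mul_eq_zero, mul_eq_zero, eigenOverlap, Complex.normSq_eq_zero,
      Complex.ofReal_eq_zero]
    exact or_comm
  have hfac : suppLE A B ↔ ∃ Y, A = B * Y := by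
    unfold suppLE
    constructor
    · intro h
      have : ∀ i, ∃ y, Matrix.toLin' B y = Matrix.toLin' A (Pi.single i 1) := fun i =>
        h ⟨_, rfl⟩
      choose y hy using this
      refine ⟨Matrix.of fun i j => y j i, ?_⟩
      ext i j
      have := congrFun (hy j) i
      simp only [Matrix.toLin'_apply, Matrix.mulVec_single_one] at this
      rw [Matrix.mul_apply]
      exact this.symm
    · rintro ⟨Y, hY⟩ _ ⟨x, rfl⟩
      refine ⟨Matrix.toLin' Y x, ?_⟩
      rw [hY, Matrix.toLin'_mul]
      rfl
  rw [hfac]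
  constructor
  · rintro ⟨Y, hY⟩ p hp
    rw [hentry]
    have : Vᴴ * A * U = Matrix.diagonal (fun i => (hB.eigenvalues i : ℂ)) * (Vᴴ * Y * U) := by
      rw [hY]
      conv_lhs => rw [hBd]
      simp only [← Matrix.mul_assoc, hVV, Matrix.one_mul]
    rw [this, Matrix.diagonal_mul, hp]
    simp
  · intro h
    refine ⟨V * Matrix.diagonal (fun i => ((hB.eigenvalues i)⁻¹ : ℂ)) * Vᴴ * A, ?_⟩
    have hUU' := eigenvectorUnitary_mul_conj hA
    rw [← hU] at hUU'
    have key : Vᴴ * A * U = Matrix.diagonal (fun i => (hB.eigenvalues i : ℂ)) *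
        (Matrix.diagonal (fun i => ((hB.eigenvalues i)⁻¹ : ℂ)) * (Vᴴ * A * U)) := by
      ext j i
      rw [Matrix.diagonal_mul, Matrix.diagonal_mul]
      by_cases hj : hB.eigenvalues j = 0
      · rw [(hentry (i, j)).mp (h (i, j) hj)]
        simp
      · rw [mul_inv_cancel_left₀ (by exact_mod_cast hj)]
    have h2 := congrArg (fun M => V * M * Uᴴ) key
    simp only [Matrix.mul_assoc, hUU', Matrix.mul_one] at h2
    rw [← Matrix.mul_assoc, hVV', Matrix.one_mul] at h2
    refine Eq.trans ?_ (congrArg (fun M => M * _) hBd.symm)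
    simp only [Matrix.mul_assoc]
    rw [← Matrix.mul_assoc Vᴴ V, hVV, Matrix.one_mul]
    exact h2

/-- The first Nussbaum–Szkoła distribution of a pair of Hermitian matrices. -/
def nsFst (hA : A.IsHermitian) (hB : B.IsHermitian) (p : κ × κ) : ℝ :=
  hA.eigenvalues p.1 * eigenOverlap hA hB p

/-- The second Nussbaum–Szkoła distribution of a pair of Hermitian matrices. -/
def nsSnd (hA : A.IsHermitian) (hB : B.IsHermitian) (p : κ × κ) : ℝ :=
  hB.eigenvalues p.2 * eigenOverlap hA hB p

lemma sum_nsFst (hA : A.IsHermitian) (hB : B.IsHermitian) :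
    ∑ p, nsFst hA hB p = hsForm A 1 := by
  have h := hsForm_cfc_cfc hA hB id 1
  rw [cfc_id_of_isHermitian hA, cfc_one_of_isHermitian hB] at h
  rw [h]
  simp [nsFst]

lemma sum_nsSnd (hA : A.IsHermitian) (hB : B.IsHermitian) :
    ∑ p, nsSnd hA hB p = hsForm B 1 := by
  have h := hsForm_cfc_cfc hA hB 1 id
  rw [cfc_id_of_isHermitian hB, cfc_one_of_isHermitian hA, hsForm_comm] at h
  rw [h]
  simp [nsSnd]

lemma suppLE_iff_ns (hA : A.IsHermitian) (hB : B.IsHermitian) :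
    suppLE A B ↔ ∀ p, nsSnd hA hB p = 0 → nsFst hA hB p = 0 := by
  rw [suppLE_iff hA hB]
  refine forall_congr' fun p => ⟨fun h h0 => ?_, fun h h0 => h ?_⟩
  · rcases mul_eq_zero.mp h0 with h1 | h1
    · exact h h1
    · rw [nsFst, h1, mul_zero]
  · rw [nsSnd, h0, zero_mul]

lemma relEnt_eq_of_suppLE (hA : A.IsHermitian) (hB : B.IsHermitian) (h : suppLE A B) :
    relEnt A B = ((∑ p, nsFst hA hB p *
      (Real.log (nsFst hA hB p) - Real.log (nsSnd hA hB p)) : ℝ) : EReal) := by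
  rw [relEnt, if_pos h, ← hsForm_apply, map_sub, matLog_eq_cfc hA, matLog_eq_cfc hB]
  congr 1
  have h1 : hsForm A (cfc Real.log A) =
      hsForm (cfc (fun x => x * Real.log x) A) (cfc (1 : ℝ → ℝ) B) := by
    have e2 : cfc (fun x => x * Real.log x) A = A * cfc Real.log A := by
      rw [cfc_mul _ _ A (continuousOn_spectrum _ _) (continuousOn_spectrum _ _),
        cfc_id' ℝ A hA.isSelfAdjoint]
    rw [cfc_one_of_isHermitian hB, e2, hsForm_one_right, hsForm_apply]
  have h2 : hsForm A (cfc Real.log B) = hsForm (cfc (id : ℝ → ℝ) A) (cfc Real.log B) := by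
    rw [cfc_id_of_isHermitian hA]
  rw [h1, h2, hsForm_cfc_cfc hA hB, hsForm_cfc_cfc hA hB, ← Finset.sum_sub_distrib]
  refine Finset.sum_congr rfl fun p _ => ?_
  simp only [nsFst, nsSnd, Pi.one_apply, mul_one, id]
  by_cases hl : hA.eigenvalues p.1 * eigenOverlap hA hB p = 0
  · have e1 : hA.eigenvalues p.1 * Real.log (hA.eigenvalues p.1) * eigenOverlap hA hB p = 0 := by
      rw [mul_right_comm, hl, zero_mul]
    have e2 : hA.eigenvalues p.1 * Real.log (hB.eigenvalues p.2) * eigenOverlap hA hB p = 0 := by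
      rw [mul_right_comm, hl, zero_mul]
    rw [hl, e1, e2, sub_zero, zero_mul]
  · have hm : hB.eigenvalues p.2 ≠ 0 := fun h0 => hl ((suppLE_iff hA hB).mp h p h0)
    have hl' := mul_ne_zero_iff.mp hl
    rw [Real.log_mul hl'.1 hl'.2, Real.log_mul hm hl'.2]
    ring

lemma hsForm_nnrpow_nnrpow (hA : 0 ≤ A) (hB : 0 ≤ B) {s t : ℝ≥0} (hs : 0 < s) (ht : 0 < t)
    (hst : t + s = 1) (hA' : A.IsHermitian) (hB' : B.IsHermitian) :
    hsForm (A ^ t) (B ^ s) = ∑ p, nsFst hA' hB' p ^ (1 - s : ℝ) * nsSnd hA' hB' p ^ (s : ℝ) := by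
  rw [CFC.nnrpow_eq_rpow hs, CFC.nnrpow_eq_rpow ht, CFC.rpow_eq_cfc_real hA,
    CFC.rpow_eq_cfc_real hB, hsForm_cfc_cfc hA' hB']
  have hst' : (1 - s : ℝ) = t := by
    rw [← NNReal.coe_one, ← hst]; push_cast; ring
  rw [hst']
  refine Finset.sum_congr rfl fun p _ => ?_
  have h1 : 0 ≤ hA'.eigenvalues p.1 :=
    (Matrix.nonneg_iff_posSemidef.mp hA).eigenvalues_nonneg p.1
  have h2 : 0 ≤ hB'.eigenvalues p.2 :=
    (Matrix.nonneg_iff_posSemidef.mp hB).eigenvalues_nonneg p.2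
  have h3 := eigenOverlap_nonneg hA' hB' p
  rw [nsFst, nsSnd, Real.mul_rpow h1 h3, Real.mul_rpow h2 h3]
  have h4 : eigenOverlap hA' hB' p = eigenOverlap hA' hB' p ^ (t : ℝ) *
      eigenOverlap hA' hB' p ^ (s : ℝ) := by
    rw [← Real.rpow_add_of_nonneg h3 t.coe_nonneg s.coe_nonneg, ← NNReal.coe_add, hst,
      NNReal.coe_one,
      Real.rpow_one]
  conv_lhs => rw [h4]
  ring

lemma nsFst_nonneg (hA : 0 ≤ A) (hA' : A.IsHermitian) (hB' : B.IsHermitian) (p : κ × κ) :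
    0 ≤ nsFst hA' hB' p :=
  mul_nonneg ((Matrix.nonneg_iff_posSemidef.mp hA).eigenvalues_nonneg p.1)
    (eigenOverlap_nonneg _ _ _)

lemma nsSnd_nonneg (hB : 0 ≤ B) (hA' : A.IsHermitian) (hB' : B.IsHermitian) (p : κ × κ) :
    0 ≤ nsSnd hA' hB' p :=
  mul_nonneg ((Matrix.nonneg_iff_posSemidef.mp hB).eigenvalues_nonneg p.2)
    (eigenOverlap_nonneg _ _ _)

/-- If `b < D(A‖B)` then `e^{s b} Tr[A^{1-s} B^s] < 1` for `s = 1/k` with `k` large. -/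
lemma exists_exp_mul_hsForm_nnrpow_lt_one (hA : IsState A) (hB : IsState B) {b : ℝ}
    (hb : (b : EReal) < relEnt A B) :
    ∃ k : ℕ, 0 < k ∧ Real.exp (b / (k + 1)) *
      hsForm (A ^ ((k : ℝ≥0) / (k + 1))) (B ^ ((1 : ℝ≥0) / (k + 1))) < 1 := by
  have hA' := hA.1.1
  have hB' := hB.1.1
  have h := eventually_exp_mul_sum_rpow_lt_one (b := b) (nsFst_nonneg hA.nonneg hA' hB')
    (nsSnd_nonneg hB.nonneg hA' hB') (by rw [sum_nsFst, hA.hsForm_one]) (fun hac => by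
      rw [relEnt_eq_of_suppLE hA' hB' ((suppLE_iff_ns hA' hB').mpr hac)] at hb
      exact_mod_cast hb)
  have ht : Tendsto (fun k : ℕ => 1 / ((k : ℝ) + 1)) atTop (𝓝[>] 0) :=
    tendsto_nhdsWithin_iff.mpr ⟨tendsto_one_div_add_atTop_nhds_zero_nat,
      Eventually.of_forall fun k => by
        have : (0 : ℝ) < (k : ℝ) + 1 := by positivity
        exact div_pos one_pos this⟩
  obtain ⟨k, hk, hk0⟩ := ((ht.eventually h).and (eventually_gt_atTop 0)).exists
  refine ⟨k, hk0, ?_⟩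
  have hk0' : (0 : ℝ≥0) < k := by exact_mod_cast hk0
  rw [hsForm_nnrpow_nnrpow hA.nonneg hB.nonneg (by positivity) (by positivity)
    (by field_simp) hA' hB']
  have e : ((1 / ((k : ℝ≥0) + 1) : ℝ≥0) : ℝ) = 1 / ((k : ℝ) + 1) := by push_cast; rfl
  rw [e]
  have e2 : b / ((k : ℝ) + 1) = 1 / ((k : ℝ) + 1) * b := by ring
  rw [e2]
  exact hk

/-- Lower bound on test errors through the Nussbaum–Szkoła distributions. -/
lemma sum_min_ns_le (hA : IsState A) (hB : IsState B) {E : Matrix κ κ ℂ} (hE0 : 0 ≤ E)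
    (hE1 : E ≤ 1) {t : ℝ} (ht : 0 ≤ t) :
    ∑ p, min (nsFst hA.1.1 hB.1.1 p) (t * nsSnd hA.1.1 hB.1.1 p)
      ≤ 2 * (hsForm A (1 - E) + t * hsForm B E) := by
  have hA' := hA.1.1
  have hB' := hB.1.1
  have hsq : ∀ {F : Matrix κ κ ℂ}, 0 ≤ F → F ≤ 1 → F * F ≤ F := by
    intro F h0 h1
    have hsa : IsSelfAdjoint F := .of_nonneg h0
    have e : F * F = cfc (fun x : ℝ => x * x) F := by
      rw [cfc_mul _ _ F (continuousOn_spectrum _ _) (continuousOn_spectrum _ _), cfc_id' ℝ F]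
    rw [e]
    conv_rhs => rw [← cfc_id' ℝ F]
    refine cfc_mono (fun x hx => ?_) (continuousOn_spectrum _ _) (continuousOn_spectrum _ _)
    have hx0 : 0 ≤ x := spectrum_nonneg_of_nonneg h0 hx
    have hx1 : x ≤ 1 := (cfc_le_one_iff (fun x : ℝ => x) F (continuousOn_spectrum _ _)).mp
        (by rw [cfc_id' ℝ F]; exact h1) x hx
    nlinarith
  have hF0 : 0 ≤ 1 - E := sub_nonneg.mpr hE1
  have hF1 : 1 - E ≤ 1 := sub_le_self _ hE0
  have h1 := hsForm_mono_right hA.nonneg (hsq hF0 hF1)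
  have h2 := hsForm_mono_right hB.nonneg (hsq hE0 hE1)
  rw [hsForm_sq hA' hB' (Matrix.nonneg_iff_posSemidef.mp hF0).1] at h1
  rw [hsForm_sq hB' hA' (Matrix.nonneg_iff_posSemidef.mp hE0).1] at h2
  refine le_trans ?_ (mul_le_mul_of_nonneg_left (add_le_add h1
    (mul_le_mul_of_nonneg_left h2 ht)) two_pos.le)
  rw [← (Equiv.prodComm κ κ).sum_comp (fun p => hB'.eigenvalues p.1 * _), Finset.mul_sum,
    ← Finset.sum_add_distrib, Finset.mul_sum]
  refine Finset.sum_le_sum fun p _ => ?_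
  simp only [Equiv.prodComm_apply, Prod.fst_swap, Prod.snd_swap]
  set U := (hA'.eigenvectorUnitary : Matrix κ κ ℂ)
  set V := (hB'.eigenvectorUnitary : Matrix κ κ ℂ)
  set x := (Vᴴ * (1 - E) * U) p.2 p.1 with hx
  set y := (Uᴴ * E * V) p.1 p.2 with hy
  have hy' : Complex.normSq y = Complex.normSq ((Vᴴ * E * U) p.2 p.1) := by
    have : Uᴴ * E * V = (Vᴴ * E * U)ᴴ := by
      simp only [Matrix.conjTranspose_mul, Matrix.conjTranspose_conjTranspose,
        (Matrix.nonneg_iff_posSemidef.mp hE0).1.eq, Matrix.mul_assoc]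
    rw [hy, this, Matrix.conjTranspose_apply, RCLike.star_def, Complex.normSq_conj]
  have hov : eigenOverlap hA' hB' p ≤ 2 * (Complex.normSq x + Complex.normSq y) := by
    have : (Vᴴ * U) p.2 p.1 = x + (Vᴴ * E * U) p.2 p.1 := by
      rw [hx, ← Matrix.add_apply]
      simp only [Matrix.mul_sub, Matrix.sub_mul, Matrix.mul_one, sub_add_cancel]
    rw [hy', eigenOverlap, this]
    simp only [Complex.normSq_apply, Complex.add_re, Complex.add_im]
    nlinarith [sq_nonneg (x.re - ((Vᴴ * E * U) p.2 p.1).re),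
      sq_nonneg (x.im - ((Vᴴ * E * U) p.2 p.1).im)]
  have hl : 0 ≤ hA'.eigenvalues p.1 := hA.1.eigenvalues_nonneg p.1
  have hm : 0 ≤ t * hB'.eigenvalues p.2 := mul_nonneg ht (hB.1.eigenvalues_nonneg p.2)
  rw [nsFst, nsSnd, ← mul_assoc, ← min_mul_of_nonneg _ _ (eigenOverlap_nonneg hA' hB' p),
    ← mul_assoc t]
  have hmin : 0 ≤ min (hA'.eigenvalues p.1) (t * hB'.eigenvalues p.2) := le_min hl hm
  refine (mul_le_mul_of_nonneg_left hov hmin).trans ?_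
  have e1 := mul_le_mul_of_nonneg_right (min_le_left (hA'.eigenvalues p.1)
    (t * hB'.eigenvalues p.2)) (Complex.normSq_nonneg x)
  have e2 := mul_le_mul_of_nonneg_right (min_le_right (hA'.eigenvalues p.1)
    (t * hB'.eigenvalues p.2)) (Complex.normSq_nonneg y)
  linarith

/-- Weak converse: a finite relative entropy limits the performance of any test. -/
lemma relEnt_test_bound (hA : IsState A) (hB : IsState B) {E : Matrix κ κ ℂ} (hE0 : 0 ≤ E)
    (hE1 : E ≤ 1) {a D : ℝ} (ha : 0 < a) (hD : relEnt A B ≤ D) :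
    1 - (D + 1) / a ≤ 2 * (hsForm A (1 - E) + Real.exp a * hsForm B E) := by
  have hs : suppLE A B := by
    by_contra hs
    rw [relEnt, if_neg hs] at hD
    exact absurd hD (by simp)
  rw [relEnt_eq_of_suppLE hA.1.1 hB.1.1 hs] at hD
  have hD' : _ ≤ D := EReal.coe_le_coe_iff.mp hD
  refine le_trans ?_ (sum_min_ns_le hA hB hE0 hE1 (Real.exp_pos a).le)
  refine le_trans ?_ (one_sub_le_sum_min (nsFst_nonneg hA.nonneg hA.1.1 hB.1.1)
    (nsSnd_nonneg hB.nonneg hA.1.1 hB.1.1) (by rw [sum_nsFst, hA.hsForm_one])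
    (by rw [sum_nsSnd, hB.hsForm_one]) ((suppLE_iff_ns hA.1.1 hB.1.1).mp hs) ha)
  gcongr

lemma relEnt_nonneg (hA : IsState A) (hB : IsState B) : 0 ≤ relEnt A B := by
  by_cases hs : suppLE A B
  · rw [relEnt_eq_of_suppLE hA.1.1 hB.1.1 hs]
    exact_mod_cast sum_mul_log_sub_nonneg (nsFst_nonneg hA.nonneg hA.1.1 hB.1.1)
      (nsSnd_nonneg hB.nonneg hA.1.1 hB.1.1) (by rw [sum_nsFst, hA.hsForm_one])
      (by rw [sum_nsSnd, hB.hsForm_one]) ((suppLE_iff_ns hA.1.1 hB.1.1).mp hs)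
  · rw [relEnt, if_neg hs]
    exact le_top

end NussbaumSzkola

section Tensor

set_option linter.unusedSectionVars false

open scoped MatrixOrder Matrix.Norms.L2Operator NNReal

variable {ι : Type*} [Fintype ι] [DecidableEq ι] {n m : ℕ}

lemma prod_update_entry {ι : Type*} {n : ℕ} [DecidableEq (Fin n)] (f : Fin n → MatC ι)
    (k : Fin n) (z : MatC ι)
    (i j : Fin n → ι) : tensorProdFam (Function.update f k z) i j
      = z (i k) (j k) * ∏ l ∈ Finset.univ.erase k, f l (i l) (j l) := by
  unfold tensorProdFam
  rw [← Finset.mul_prod_erase _ _ (Finset.mem_univ k), Function.update_self]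
  congr 1
  exact Finset.prod_congr rfl fun l hl => by
    rw [Function.update_of_ne (Finset.ne_of_mem_erase hl)]

/-- `tensorProdFam` as a real multilinear map. -/
def tensorMultilinear (ι : Type*) (n : ℕ) :
    MultilinearMap ℝ (fun _ : Fin n => MatC ι) (MatN ι n) where
  toFun f := tensorProdFam f
  map_update_add' f k x y := by
    ext i j
    exact (prod_update_entry f k (x + y) i j).trans <| by
      rw [Matrix.add_apply, add_mul, ← prod_update_entry f k x, ← prod_update_entry f k y]
      rfl
  map_update_smul' f k c x := by
    ext i j
    exact (prod_update_entry f k (c • x) i j).trans <| by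
      rw [Matrix.smul_apply, smul_mul_assoc, ← prod_update_entry f k x]
      rfl

lemma tensorMultilinear_apply (f : Fin n → MatC ι) :
    tensorMultilinear ι n f = tensorProdFam f := rfl

lemma tensorPow_eq (ρ : MatC ι) (n : ℕ) : tensorPow ρ n = tensorProdFam fun _ : Fin n => ρ := rfl

lemma tensorProdFam_nonneg {f : Fin n → MatC ι} (hf : ∀ k, 0 ≤ f k) : 0 ≤ tensorProdFam f := by
  rw [Matrix.nonneg_iff_posSemidef]
  have h : ∀ s : Finset (Fin n), Matrix.PosSemidef
      (Matrix.of fun i j : Fin n → ι => ∏ k ∈ s, f k (i k) (j k)) := by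
    intro s
    induction s using Finset.induction_on with
    | empty =>
      convert Matrix.posSemidef_vecMulVec_self_star (fun _ : Fin n → ι => (1 : ℂ)) using 1
      ext i j
      simp [Matrix.vecMulVec_apply]
    | insert a s ha ih =>
      have h := ((Matrix.nonneg_iff_posSemidef.mp (hf a)).submatrix
        (fun i : Fin n → ι => i a)).hadamard ih
      have e : (Matrix.of fun i j : Fin n → ι => ∏ k ∈ insert a s, f k (i k) (j k)) =
          ((f a).submatrix (fun i : Fin n → ι => i a) (fun i => i a)).hadamard
            (Matrix.of fun i j => ∏ k ∈ s, f k (i k) (j k)) := by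
        ext i j
        simp [Finset.prod_insert ha]
      rw [e]
      exact h
  exact h Finset.univ

lemma tensorProdFam_mono {f g : Fin n → MatC ι} (hf : ∀ k, 0 ≤ f k) (hfg : ∀ k, f k ≤ g k) :
    tensorProdFam f ≤ tensorProdFam g := by
  have h := (tensorMultilinear ι n).map_add_univ f (g - f)
  rw [add_sub_cancel] at h
  rw [← tensorMultilinear_apply g, h]
  refine (le_of_eq ?_).trans (Finset.single_le_sum (f := fun s : Finset (Fin n) =>
    tensorMultilinear ι n (s.piecewise f (g - f))) (fun s _ => tensorProdFam_nonneg fun k => ?_)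
    (Finset.mem_univ Finset.univ))
  · simp [tensorMultilinear_apply]
  · by_cases hk : k ∈ s
    · simpa [hk] using hf k
    · simpa [hk] using hfg k

lemma trace_tensorProdFam (f : Fin n → MatC ι) :
    (tensorProdFam f).trace = ∏ k, (f k).trace := by
  simp only [Matrix.trace, Matrix.diag_apply, tensorProdFam]
  rw [Finset.prod_univ_sum, Fintype.piFinset_univ]

lemma isState_tensorProdFam {f : Fin n → MatC ι} (hf : ∀ k, IsState (f k)) :
    IsState (tensorProdFam f) :=
  ⟨Matrix.nonneg_iff_posSemidef.mp (tensorProdFam_nonneg fun k => (hf k).nonneg), by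
    rw [trace_tensorProdFam]; exact Finset.prod_eq_one fun k _ => (hf k).2⟩

lemma isState_tensorPow {ρ : MatC ι} (hρ : IsState ρ) (n : ℕ) : IsState (tensorPow ρ n) :=
  isState_tensorProdFam fun _ => hρ

lemma tensorPow_nonneg {ρ : MatC ι} (hρ : 0 ≤ ρ) (n : ℕ) : 0 ≤ tensorPow ρ n :=
  tensorProdFam_nonneg fun _ => hρ

lemma tensorPow_mono {ρ σ : MatC ι} (hρ : 0 ≤ ρ) (h : ρ ≤ σ) (n : ℕ) :
    tensorPow ρ n ≤ tensorPow σ n :=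
  tensorProdFam_mono (fun _ => hρ) fun _ => h

lemma tensorPow_smul (c : ℝ) (ρ : MatC ι) (n : ℕ) :
    tensorPow (c • ρ) n = c ^ n • tensorPow ρ n := by
  have := (tensorMultilinear ι n).map_smul_univ (fun _ => c) (fun _ => ρ)
  simpa [tensorMultilinear_apply, tensorPow_eq] using this

lemma tensorProdFam_smul (c : ℝ) (f : Fin n → MatC ι) :
    tensorProdFam (fun k => c • f k) = c ^ n • tensorProdFam f := by
  have := (tensorMultilinear ι n).map_smul_univ (fun _ => c) f
  simpa [tensorMultilinear_apply] using this

/-- `tensorMul` as a real bilinear map. -/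
def tensorBilin (ι : Type*) (n m : ℕ) : MatN ι n →ₗ[ℝ] MatN ι m →ₗ[ℝ] MatN ι (n + m) :=
  LinearMap.mk₂ ℝ tensorMul
    (fun A A' B => by ext i j; simp [tensorMul, add_mul])
    (fun c A B => by ext i j; simp [tensorMul, mul_assoc])
    (fun A B B' => by ext i j; simp [tensorMul, mul_add])
    (fun c A B => by ext i j; simp [tensorMul, mul_left_comm])

lemma tensorBilin_apply (A : MatN ι n) (B : MatN ι m) : tensorBilin ι n m A B = tensorMul A B :=
  rfl

lemma tensorMul_nonneg {A : MatN ι n} {B : MatN ι m} (hA : 0 ≤ A) (hB : 0 ≤ B) :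
    0 ≤ tensorMul A B := by
  rw [Matrix.nonneg_iff_posSemidef] at *
  exact (hA.submatrix fun (i : Fin (n + m) → ι) t => i (Fin.castAdd m t)).hadamard
    (hB.submatrix fun (i : Fin (n + m) → ι) t => i (Fin.natAdd n t))

lemma tensorMul_mono_right {A : MatN ι n} {B B' : MatN ι m} (hA : 0 ≤ A) (hB : B ≤ B') :
    tensorMul A B ≤ tensorMul A B' := by
  have := tensorMul_nonneg hA (sub_nonneg.mpr hB)
  rwa [← tensorBilin_apply, map_sub, sub_nonneg] at this

lemma tensorMul_tensorPow (ρ : MatC ι) (n m : ℕ) :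
    tensorMul (tensorPow ρ n) (tensorPow ρ m) = tensorPow ρ (n + m) := by
  ext i j
  simp [tensorMul, tensorPow, Fin.prod_univ_add]

lemma tensorMul_mul (A A' : MatN ι n) (B B' : MatN ι m) :
    tensorMul A B * tensorMul A' B' = tensorMul (A * A') (B * B') := by
  ext i j
  simp only [Matrix.mul_apply, tensorMul]
  rw [← (Fin.appendEquiv n m (α := ι)).sum_comp, Fintype.sum_prod_type, Finset.sum_mul_sum]
  refine Finset.sum_congr rfl fun a _ => Finset.sum_congr rfl fun b _ => ?_
  simp only [Fin.appendEquiv, Equiv.coe_fn_mk, Fin.append_left, Fin.append_right]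
  ring

lemma trace_tensorMul (A : MatN ι n) (B : MatN ι m) :
    (tensorMul A B).trace = A.trace * B.trace := by
  simp only [Matrix.trace, Matrix.diag_apply, tensorMul]
  rw [← (Fin.appendEquiv n m (α := ι)).sum_comp, Fintype.sum_prod_type, Finset.sum_mul_sum]
  refine Finset.sum_congr rfl fun a _ => Finset.sum_congr rfl fun b _ => ?_
  simp only [Fin.appendEquiv, Equiv.coe_fn_mk, Fin.append_left, Fin.append_right]

lemma trace_mul_im_eq_zero {κ : Type*} [Fintype κ] {A B : Matrix κ κ ℂ} (hA : A.IsHermitian)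
    (hB : B.IsHermitian) : (A * B).trace.im = 0 := by
  have h : star (A * B).trace = (A * B).trace := by
    rw [← Matrix.trace_conjTranspose, Matrix.conjTranspose_mul, hA.eq, hB.eq,
      Matrix.trace_mul_comm]
  exact Complex.conj_eq_iff_im.mp h

lemma hsForm_tensorMul {A A' : MatN ι n} {B B' : MatN ι m} (hA : A.IsHermitian)
    (hA' : A'.IsHermitian) :
    hsForm (tensorMul A B) (tensorMul A' B') = hsForm A A' * hsForm B B' := by
  rw [hsForm_apply, tensorMul_mul, trace_tensorMul, Complex.mul_re,
    trace_mul_im_eq_zero hA hA', zero_mul, sub_zero]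
  rfl

lemma tensorMul_pow (A : MatN ι n) (B : MatN ι m) (k : ℕ) :
    tensorMul A B ^ (k + 1) = tensorMul (A ^ (k + 1)) (B ^ (k + 1)) := by
  induction k with
  | zero => simp
  | succ k ih => rw [pow_succ, ih, tensorMul_mul, ← pow_succ, ← pow_succ]

lemma nnrpow_natCast_succ {κ : Type*} [Fintype κ] [DecidableEq κ] {A : Matrix κ κ ℂ} (hA : 0 ≤ A)
    (k : ℕ) : A ^ (((k + 1 : ℕ) : ℝ≥0)) = A ^ (k + 1) := by
  rw [CFC.nnrpow_eq_rpow (by positivity), NNReal.coe_natCast, CFC.rpow_natCast A (k + 1) hA]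

lemma nnrpow_inv_pow_succ {κ : Type*} [Fintype κ] [DecidableEq κ] {A : Matrix κ κ ℂ} (hA : 0 ≤ A)
    (k : ℕ) : (A ^ ((1 : ℝ≥0) / (k + 1))) ^ (k + 1) = A := by
  have h0 : 0 ≤ A ^ ((1 : ℝ≥0) / (k + 1)) := CFC.nnrpow_nonneg
  rw [← nnrpow_natCast_succ h0, CFC.nnrpow_nnrpow]
  have : ((1 : ℝ≥0) / (k + 1)) * ((k + 1 : ℕ) : ℝ≥0) = 1 := by push_cast; field_simp
  rw [this, CFC.nnrpow_one A hA]

lemma pow_succ_nnrpow_inv {κ : Type*} [Fintype κ] [DecidableEq κ] {A : Matrix κ κ ℂ} (hA : 0 ≤ A)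
    (k : ℕ) : (A ^ (k + 1)) ^ ((1 : ℝ≥0) / (k + 1)) = A := by
  rw [← nnrpow_natCast_succ hA, CFC.nnrpow_nnrpow]
  have : ((k + 1 : ℕ) : ℝ≥0) * ((1 : ℝ≥0) / (k + 1)) = 1 := by push_cast; field_simp
  rw [this, CFC.nnrpow_one A hA]

lemma nnrpow_div_eq_pow {κ : Type*} [Fintype κ] [DecidableEq κ] (A : Matrix κ κ ℂ) (l : ℕ) :
    A ^ (((l + 1 : ℕ) : ℝ≥0) / ((l + 1 : ℕ) + 1)) =
      (A ^ ((1 : ℝ≥0) / ((l + 1 : ℕ) + 1))) ^ (l + 1) := by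
  have h0 : 0 ≤ A ^ ((1 : ℝ≥0) / ((l + 1 : ℕ) + 1)) := CFC.nnrpow_nonneg
  rw [← nnrpow_natCast_succ h0, CFC.nnrpow_nnrpow]
  congr 1
  field_simp

lemma tensorMul_nnrpow_inv {A : MatN ι n} {B : MatN ι m} (hA : 0 ≤ A) (hB : 0 ≤ B) (k : ℕ) :
    tensorMul A B ^ ((1 : ℝ≥0) / (k + 1)) =
      tensorMul (A ^ ((1 : ℝ≥0) / (k + 1))) (B ^ ((1 : ℝ≥0) / (k + 1))) := by
  have hA0 : 0 ≤ A ^ ((1 : ℝ≥0) / (k + 1)) := CFC.nnrpow_nonneg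
  have hB0 : 0 ≤ B ^ ((1 : ℝ≥0) / (k + 1)) := CFC.nnrpow_nonneg
  have h := tensorMul_pow (A ^ ((1 : ℝ≥0) / (k + 1))) (B ^ ((1 : ℝ≥0) / (k + 1))) k
  rw [nnrpow_inv_pow_succ hA, nnrpow_inv_pow_succ hB] at h
  rw [← h, pow_succ_nnrpow_inv (tensorMul_nonneg hA0 hB0)]

lemma tensorMul_nnrpow {A : MatN ι n} {B : MatN ι m} (hA : 0 ≤ A) (hB : 0 ≤ B) {k : ℕ}
    (hk : 0 < k) :
    tensorMul A B ^ ((k : ℝ≥0) / (k + 1)) =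
      tensorMul (A ^ ((k : ℝ≥0) / (k + 1))) (B ^ ((k : ℝ≥0) / (k + 1))) := by
  obtain ⟨l, rfl⟩ := Nat.exists_eq_succ_of_ne_zero hk.ne'
  have h1 := nnrpow_div_eq_pow (tensorMul A B) l
  have h2 := nnrpow_div_eq_pow A l
  have h3 := nnrpow_div_eq_pow B l
  rw [tensorMul_nnrpow_inv hA hB, tensorMul_pow, ← h2, ← h3] at h1
  exact h1

lemma permCopies_eq_submatrix (π : Equiv.Perm (Fin n)) (E : MatN ι n) :
    permCopies π E = E.submatrix (fun i => i ∘ π) (fun i => i ∘ π) := rfl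

lemma permCopies_nonneg (π : Equiv.Perm (Fin n)) {E : MatN ι n} (hE : 0 ≤ E) :
    0 ≤ permCopies π E := by
  rw [Matrix.nonneg_iff_posSemidef] at *
  exact hE.submatrix _

lemma permCopies_one (π : Equiv.Perm (Fin n)) : permCopies π (1 : MatN ι n) = 1 := by
  rw [permCopies_eq_submatrix]
  exact Matrix.submatrix_one _ (fun i j h => by
    funext k
    simpa using congrFun h (π.symm k))

lemma permCopies_sub (π : Equiv.Perm (Fin n)) (E F : MatN ι n) :
    permCopies π (E - F) = permCopies π E - permCopies π F := rfl

lemma hsForm_permCopies (f : Fin n → MatC ι) (π : Equiv.Perm (Fin n)) (E : MatN ι n) :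
    hsForm (tensorProdFam f) (permCopies π E) = hsForm (tensorProdFam (f ∘ π)) E := by
  rw [hsForm_apply, hsForm_apply]
  congr 1
  simp only [Matrix.trace, Matrix.diag_apply, Matrix.mul_apply]
  rw [← ((Equiv.arrowCongr π (Equiv.refl ι))).sum_comp]
  refine Finset.sum_congr rfl fun i _ => ?_
  rw [← ((Equiv.arrowCongr π (Equiv.refl ι))).sum_comp]
  refine Finset.sum_congr rfl fun j _ => ?_
  simp only [permCopies, tensorProdFam, Equiv.arrowCongr_apply, Equiv.coe_refl, Function.comp_def,
    id, Equiv.symm_apply_apply]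
  rw [← Equiv.prod_comp π (fun k => f k (i (π.symm k)) (j (π.symm k)))]
  simp

/-- Average of an operator over all permutations of the tensor factors. -/
def symTest (E : MatN ι n) : MatN ι n :=
  ((Fintype.card (Equiv.Perm (Fin n)) : ℝ)⁻¹) • ∑ π : Equiv.Perm (Fin n), permCopies π E

lemma symTest_nonneg {E : MatN ι n} (hE : 0 ≤ E) : 0 ≤ symTest E :=
  smul_nonneg (by positivity) (Finset.sum_nonneg fun π _ => permCopies_nonneg π hE)

lemma one_sub_symTest (E : MatN ι n) : 1 - symTest E = symTest (1 - E) := by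
  have h1 : symTest (1 : MatN ι n) = 1 := by
    simp only [symTest, permCopies_one, Finset.sum_const, Finset.card_univ]
    rw [← Nat.cast_smul_eq_nsmul ℝ, smul_smul, inv_mul_cancel₀ (by positivity), one_smul]
  conv_lhs => rw [← h1]
  simp only [symTest, permCopies_sub, Finset.sum_sub_distrib, smul_sub]

lemma hsForm_symTest (f : Fin n → MatC ι) (E : MatN ι n) :
    hsForm (tensorProdFam f) (symTest E) = ((Fintype.card (Equiv.Perm (Fin n)) : ℝ)⁻¹) *
      ∑ π : Equiv.Perm (Fin n), hsForm (tensorProdFam (f ∘ π)) E := by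
  rw [symTest, map_smul, map_sum, smul_eq_mul]
  simp only [hsForm_permCopies]

lemma hsForm_tensorPow_symTest (ρ : MatC ι) (E : MatN ι n) :
    hsForm (tensorPow ρ n) (symTest E) = hsForm (tensorPow ρ n) E := by
  rw [tensorPow_eq, hsForm_symTest]
  simp only [Function.comp_def, Finset.sum_const, Finset.card_univ, nsmul_eq_mul]
  rw [inv_mul_cancel_left₀ (by positivity)]

lemma hsForm_symTest_comp (f : Fin n → MatC ι) (π : Equiv.Perm (Fin n)) (E : MatN ι n) :
    hsForm (tensorProdFam (f ∘ π)) (symTest E) = hsForm (tensorProdFam f) (symTest E) := by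
  rw [hsForm_symTest, hsForm_symTest]
  congr 1
  exact Fintype.sum_equiv (Equiv.mulLeft π) _ _ fun π' => rfl

/-- A bound on tests over product states with factors in `B` extends to the convex hull. -/
lemma hsForm_tensorProdFam_le_of_convexHull {B : Set (MatC ι)} {E : MatN ι n} {b : ℝ}
    (h : ∀ f : Fin n → MatC ι, (∀ k, f k ∈ B) → hsForm (tensorProdFam f) E ≤ b)
    {f : Fin n → MatC ι} (hf : ∀ k, f k ∈ convexHull ℝ B) : hsForm (tensorProdFam f) E ≤ b := by
  have key : ∀ s : Finset (Fin n), ∀ f : Fin n → MatC ι, (∀ k ∈ s, f k ∈ convexHull ℝ B) →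
      (∀ k ∉ s, f k ∈ B) → hsForm (tensorProdFam f) E ≤ b := by
    intro s
    induction s using Finset.induction_on with
    | empty => exact fun f _ hf => h f fun k => hf k (by simp)
    | insert a s ha ih =>
      intro f hf1 hf2
      let L : MatC ι →ₗ[ℝ] ℝ := (hsForm.flip E) ∘ₗ (tensorMultilinear ι n).toLinearMap f a
      have hL : ∀ x, L x = hsForm (tensorProdFam (Function.update f a x)) E := fun x => rfl
      have hsub : convexHull ℝ B ⊆ {x | L x ≤ b} := by
        refine convexHull_min (fun x hx => ?_) (convex_halfSpace_le L.isLinear b)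
        rw [Set.mem_ofPred_eq, hL]
        refine ih _ (fun k hk => ?_) fun k hk => ?_
        · rw [Function.update_of_ne (by rintro rfl; exact ha hk)]
          exact hf1 k (Finset.mem_insert_of_mem hk)
        · by_cases hka : k = a
          · subst hka; rwa [Function.update_self]
          · rw [Function.update_of_ne hka]
            exact hf2 k (by simp [hka, hk])
      have := hsub (hf1 a (Finset.mem_insert_self _ _))
      rwa [Set.mem_ofPred_eq, hL, Function.update_eq_self] at this
  exact key Finset.univ f (fun k _ => hf k) (fun k hk => absurd (Finset.mem_univ k) hk)

end Tensor

section Domination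

open scoped MatrixOrder Matrix.Norms.L2Operator NNReal

variable {κ : Type*} [Fintype κ] [DecidableEq κ]

lemma IsState.le_one {ρ : Matrix κ κ ℂ} (h : IsState ρ) : ρ ≤ 1 := by
  have hH := h.1.isHermitian
  rw [← cfc_id_of_isHermitian hH, cfc_le_one_iff (id : ℝ → ℝ) ρ (continuousOn_spectrum _ _)
    hH.isSelfAdjoint]
  intro x hx
  rw [hH.spectrum_real_eq_range_eigenvalues] at hx
  obtain ⟨i, rfl⟩ := hx
  have htr := hH.trace_eq_sum_eigenvalues
  rw [h.2] at htr
  have htr' : (1 : ℝ) = ∑ i, hH.eigenvalues i :=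
    Complex.ofReal_injective (by simpa using htr)
  rw [id, htr']
  exact Finset.single_le_sum (fun j _ => h.1.eigenvalues_nonneg j) (Finset.mem_univ i)

lemma IsState.norm_le_one {ρ : Matrix κ κ ℂ} (h : IsState ρ) : ‖ρ‖ ≤ 1 :=
  (CStarAlgebra.norm_le_one_iff_of_nonneg ρ h.nonneg).2 h.le_one

lemma exists_finset_dominating {C : Set (Matrix κ κ ℂ)} (hC : Convex ℝ C) (hne : C.Nonempty)
    (hst : ∀ σ ∈ C, IsState σ) {δ : ℝ} (hδ : 0 < δ) :
    ∃ s : Finset (Matrix κ κ ℂ), ↑s ⊆ C ∧ ∀ σ ∈ C, ∃ τ ∈ s, σ ≤ (1 + δ) • τ := by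
  obtain ⟨b, hbC, hspan, hli⟩ := exists_linearIndependent ℝ C
  have : Fintype b := hli.setFinite.fintype
  have hb : Nonempty b := by
    by_contra hb
    obtain ⟨σ, hσ⟩ := hne
    have hmem : σ ∈ Submodule.span ℝ b := hspan ▸ Submodule.subset_span hσ
    rw [Set.not_nonempty_iff_eq_empty'.1 hb, Submodule.span_empty, Submodule.mem_bot] at hmem
    have := (hst σ hσ).2
    simp [hmem] at this
  set Φ := Fintype.linearCombination ℝ (fun i : b => (i : Matrix κ κ ℂ))
  obtain ⟨K, hK, hΦ⟩ := Φ.exists_antilipschitzWith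
    (LinearMap.ker_eq_bot.2 hli.fintypeLinearCombination_injective)
  set N : ℝ := ((Fintype.card b : ℕ) : ℝ)
  have hN : 0 < N := Nat.cast_pos.2 Fintype.card_pos
  set ω : Matrix κ κ ℂ := ∑ i : b, N⁻¹ • (i : Matrix κ κ ℂ) with hωdef
  have hω : ω ∈ C := by
    refine hC.sum_mem (fun i _ => by positivity) ?_ fun i _ => hbC i.2
    simp only [Finset.sum_const, Finset.card_univ, nsmul_eq_mul]
    exact mul_inv_cancel₀ hN.ne'
  have : ProperSpace (Matrix κ κ ℂ) := FiniteDimensional.proper ℝ _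
  have htb : TotallyBounded C :=
    (isCompact_closedBall (0 : Matrix κ κ ℂ) 1).totallyBounded.subset fun σ hσ => by
      simpa using (hst σ hσ).norm_le_one
  have hK' : (0 : ℝ) < K := hK
  have hε : 0 < δ / (K * N) := by positivity
  obtain ⟨t, htC, htf, ht⟩ := totallyBounded_iff_subset.1 htb _ (Metric.dist_mem_uniformity hε)
  refine ⟨htf.toFinset.image fun ν => (1 / (1 + δ)) • ν + (δ / (1 + δ)) • ω, ?_, ?_⟩
  · intro x hx
    obtain ⟨ν, hν, rfl⟩ := Finset.mem_image.1 (Finset.mem_coe.1 hx)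
    exact hC (htC (htf.mem_toFinset.1 hν)) hω (by positivity) (by positivity) (by field_simp)
  · intro σ hσ
    obtain ⟨ν, hν, hσν⟩ := Set.mem_iUnion₂.1 (ht hσ)
    replace hσν : dist σ ν < δ / (K * N) := hσν
    refine ⟨_, Finset.mem_image_of_mem _ (htf.mem_toFinset.2 hν), ?_⟩
    have hmem : σ - ν ∈ Φ.range := by
      rw [Fintype.range_linearCombination, Subtype.range_coe, hspan]
      exact sub_mem (Submodule.subset_span hσ) (Submodule.subset_span (htC hν))
    obtain ⟨c, hc⟩ := hmem
    have hcn : ‖c‖ ≤ δ / N := by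
      have h1 := hΦ.le_mul_dist c 0
      rw [map_zero, hc, dist_zero_right, dist_zero_right, ← dist_eq_norm] at h1
      calc ‖c‖ ≤ K * dist σ ν := h1
        _ ≤ K * (δ / (K * N)) := by gcongr
        _ = δ / N := by field_simp
    have hle : σ - ν ≤ δ • ω := by
      rw [← hc, Fintype.linearCombination_apply, hωdef, Finset.smul_sum]
      refine Finset.sum_le_sum fun i _ => ?_
      rw [smul_smul]
      refine smul_le_smul_of_nonneg_right ?_ (hst i (hbC i.2)).nonneg
      exact ((le_abs_self _).trans (norm_le_pi_norm c i)).trans (hcn.trans_eq (div_eq_mul_inv _ _))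
    have : (1 + δ) • ((1 / (1 + δ)) • ν + (δ / (1 + δ)) • ω) = ν + δ • ω := by
      have h1 : 1 + δ ≠ 0 := by positivity
      rw [smul_add, smul_smul, smul_smul, mul_one_div_cancel h1, mul_div_cancel₀ _ h1, one_smul]
    rw [this]
    exact sub_le_iff_le_add'.1 hle

end Domination

section Types

open scoped MatrixOrder Matrix.Norms.L2Operator NNReal Nat

lemma factorial_mul_exp_le (t : ℕ) :
    (t ! : ℝ) * Real.exp t ≤ Real.exp 1 * (t + 1) * (t : ℝ) ^ t := by
  have key : ∀ t : ℕ, ((t + 1)! : ℝ) * Real.exp (t + 1) ≤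
      Real.exp 1 * (t + 1) * ((t : ℝ) + 1) ^ (t + 1) := by
    intro t
    induction t with
    | zero => simp
    | succ t ih =>
      have h1 : Real.exp 1 * ((t : ℝ) + 1) ^ (t + 2) ≤ ((t : ℝ) + 2) ^ (t + 2) := by
        have h2 : ((t : ℝ) + 1) / (t + 2) ≤ Real.exp (-(1 / (t + 2))) := by
          refine le_trans (le_of_eq ?_) (Real.add_one_le_exp _)
          field_simp; ring
        have h3 := pow_le_pow_left₀ (by positivity) h2 (t + 2)
        rw [← Real.exp_nat_mul, div_pow, div_le_iff₀ (by positivity)] at h3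
        have h4 : ((t + 2 : ℕ) : ℝ) * -(1 / ((t : ℝ) + 2)) = -1 := by push_cast; field_simp
        rw [h4] at h3
        calc Real.exp 1 * ((t : ℝ) + 1) ^ (t + 2)
            ≤ Real.exp 1 * (Real.exp (-1) * ((t : ℝ) + 2) ^ (t + 2)) := by gcongr
          _ = ((t : ℝ) + 2) ^ (t + 2) := by rw [← mul_assoc, ← Real.exp_add]; simp
      rw [Nat.factorial_succ (t + 1), Nat.cast_mul, Real.exp_add]
      push_cast
      calc ((t : ℝ) + 1 + 1) * (t + 1)! * (Real.exp (t + 1) * Real.exp 1)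
          = ((t : ℝ) + 2) * Real.exp 1 * ((t + 1)! * Real.exp (t + 1)) := by ring
        _ ≤ ((t : ℝ) + 2) * Real.exp 1 *
            (Real.exp 1 * (t + 1) * ((t : ℝ) + 1) ^ (t + 1)) := by gcongr
        _ = Real.exp 1 * ((t : ℝ) + 2) * (Real.exp 1 * ((t : ℝ) + 1) ^ (t + 2)) := by ring
        _ ≤ Real.exp 1 * ((t : ℝ) + 2) * ((t : ℝ) + 2) ^ (t + 2) := by gcongr
        _ = _ := by ring
  cases t with
  | zero => simp
  | succ t =>
    refine le_trans (by exact_mod_cast key t) ?_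
    push_cast
    gcongr
    linarith

variable {J : Type*} [Fintype J] [DecidableEq J] {n : ℕ}

lemma factorial_le_card_orbit (f : Fin n → J) :
    n ! ≤ (∏ j, (Finset.card {k | f k = j})!) *
      (Finset.univ.image fun π : Equiv.Perm (Fin n) => f ∘ π).card := by
  have h := Finset.card_le_mul_card_image (f := fun π : Equiv.Perm (Fin n) => f ∘ π)
    Finset.univ (∏ j, (Finset.card {k | f k = j})!) ?_
  · rwa [Finset.card_univ, Fintype.card_perm, Fintype.card_fin] at h
  · intro g hg
    obtain ⟨π, -, rfl⟩ := Finset.mem_image.1 hg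
    have hstab := DomMulAct.stabilizer_card f
    simp only [Fintype.card_subtype] at hstab
    rw [← hstab]
    refine Finset.card_le_card_of_injOn (fun π' => π' * π⁻¹) (fun π' hπ' => ?_)
      fun a _ b _ hab => mul_right_cancel hab
    have h1 : f ∘ π' = f ∘ π := by simpa using hπ'
    have h2 : f ∘ (π' * π⁻¹ : Equiv.Perm (Fin n)) = f := by
      rw [Equiv.Perm.coe_mul, ← Function.comp_assoc, h1, Function.comp_assoc,
        ← Equiv.Perm.coe_mul, mul_inv_cancel, Equiv.Perm.coe_one, Function.comp_id]
    simpa using h2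

/-- The empirical distribution of a string gives its permutation class a weight which is at least
inversely polynomial in the length of the string. -/
lemma one_le_card_orbit_mul_prod (f : Fin n → J) :
    1 ≤ (Real.exp 1 * (n + 1)) ^ Fintype.card J *
      ((Finset.univ.image fun π : Equiv.Perm (Fin n) => f ∘ π).card *
        ∏ k, ((Finset.card {l | f l = f k} : ℕ) / n : ℝ)) := by
  set t : J → ℕ := fun j => Finset.card {l | f l = j} with ht
  set O := (Finset.univ.image fun π : Equiv.Perm (Fin n) => f ∘ π).card
  have hsum : ∑ j, t j = n := by
    have := Finset.card_eq_sum_card_fiberwise (f := f) (s := Finset.univ) (t := Finset.univ)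
      (by simp)
    simpa using this.symm
  have hprod : ∏ k, ((t (f k) : ℝ) / n) = (∏ j, (t j : ℝ) ^ t j) / (n : ℝ) ^ n := by
    rw [← Finset.prod_fiberwise' Finset.univ f (fun j => (t j : ℝ) / n)]
    simp only [Finset.prod_const, div_pow, Finset.prod_div_distrib, Finset.prod_pow_eq_pow_sum]
    rw [← ht, hsum]
  have hn : (n : ℝ) ^ n ≤ Real.exp n * n ! := by
    have := Real.pow_div_factorial_le_exp (n : ℝ) (by positivity) n
    rwa [div_le_iff₀ (by positivity)] at this
  have hO : (n ! : ℝ) ≤ (∏ j, ((t j)! : ℝ)) * O := by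
    exact_mod_cast factorial_le_card_orbit f
  have hexp : Real.exp n * ∏ j, ((t j)! : ℝ) ≤
      (Real.exp 1 * (n + 1)) ^ Fintype.card J * ∏ j, (t j : ℝ) ^ t j := by
    have h1 : Real.exp n = ∏ j, Real.exp (t j) := by
      rw [← Real.exp_sum, ← Nat.cast_sum, hsum]
    rw [h1, ← Finset.prod_mul_distrib, ← Finset.card_univ, ← Finset.prod_const,
      ← Finset.prod_mul_distrib]
    refine Finset.prod_le_prod (fun j _ => by positivity) fun j _ => ?_
    rw [mul_comm]
    refine (factorial_mul_exp_le (t j)).trans ?_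
    have : (t j : ℝ) ≤ n := by
      exact_mod_cast hsum ▸ Finset.single_le_sum (fun _ _ => Nat.zero_le _) (Finset.mem_univ j)
    gcongr
  have hn0 : (0 : ℝ) < (n : ℝ) ^ n := by
    rcases Nat.eq_zero_or_pos n with h | h
    · simp [h]
    · positivity
  rw [hprod, mul_div_assoc', mul_div_assoc', le_div_iff₀ hn0, one_mul]
  calc (n : ℝ) ^ n ≤ Real.exp n * ((∏ j, ((t j)! : ℝ)) * O) := hn.trans (by gcongr)
    _ = (Real.exp n * ∏ j, ((t j)! : ℝ)) * O := by ring
    _ ≤ ((Real.exp 1 * (n + 1)) ^ Fintype.card J * ∏ j, (t j : ℝ) ^ t j) * O := by gcongr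
    _ = _ := by ring

variable {ι : Type*} [Fintype ι] [DecidableEq ι]

/-- For permutation-invariant tests, a product state with factors from a finite family is dominated,
up to a polynomial factor, by the tensor power of its average factor. -/
lemma hsForm_tensorProdFam_comp_le {τ : J → MatC ι} (hτ : ∀ j, 0 ≤ τ j) (f : Fin n → J)
    {E : MatN ι n} (hE : 0 ≤ E) :
    hsForm (tensorProdFam (τ ∘ f)) (symTest E) ≤ (Real.exp 1 * (n + 1)) ^ Fintype.card J *
      hsForm (tensorPow (∑ j, ((Finset.card {l | f l = j} : ℕ) / n : ℝ) • τ j) n) (symTest E) := by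
  set w : J → ℝ := fun j => ((Finset.card {l | f l = j} : ℕ) / n : ℝ) with hw
  set h : (Fin n → J) → ℝ := fun g => hsForm (tensorProdFam (τ ∘ g)) (symTest E) with hh
  have hh0 : ∀ g, 0 ≤ h g := fun g =>
    hsForm_nonneg (tensorProdFam_nonneg fun k => hτ (g k)) (symTest_nonneg hE)
  have hw0 : ∀ j, 0 ≤ w j := fun j => by positivity
  have hexpand : hsForm (tensorPow (∑ j, w j • τ j) n) (symTest E) =
      ∑ g : Fin n → J, (∏ k, w (g k)) * h g := by
    have h1 : tensorPow (∑ j, w j • τ j) n =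
        ∑ g : Fin n → J, (∏ k, w (g k)) • tensorProdFam (τ ∘ g) := by
      have := (tensorMultilinear ι n).map_sum (fun (_ : Fin n) j => w j • τ j)
      simp only [MultilinearMap.map_smul_univ] at this
      exact this
    rw [h1, map_sum, LinearMap.sum_apply]
    simp only [map_smul, LinearMap.smul_apply, smul_eq_mul, hh]
  have horb : (Finset.univ.image fun π : Equiv.Perm (Fin n) => f ∘ π).card *
      ((∏ k, w (f k)) * h f) ≤ ∑ g : Fin n → J, (∏ k, w (g k)) * h g := by
    rw [← nsmul_eq_mul, ← Finset.sum_const]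
    refine le_trans (Finset.sum_le_sum fun g hg => ?_) (Finset.sum_le_sum_of_subset_of_nonneg
      (Finset.subset_univ _) fun g _ _ => mul_nonneg (Finset.prod_nonneg fun k _ => hw0 _) (hh0 g))
    obtain ⟨π, -, rfl⟩ := Finset.mem_image.1 hg
    have h1 : h (f ∘ π) = h f := hsForm_symTest_comp (τ ∘ f) π E
    have h2 : ∏ k, w ((f ∘ π) k) = ∏ k, w (f k) := Equiv.prod_comp π fun k => w (f k)
    rw [h1, h2]
  rw [hexpand]
  calc h f ≤ ((Real.exp 1 * (n + 1)) ^ Fintype.card J *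
      ((Finset.univ.image fun π : Equiv.Perm (Fin n) => f ∘ π).card * ∏ k, w (f k))) * h f :=
        le_mul_of_one_le_left (hh0 f) (one_le_card_orbit_mul_prod f)
    _ = (Real.exp 1 * (n + 1)) ^ Fintype.card J *
      ((Finset.univ.image fun π : Equiv.Perm (Fin n) => f ∘ π).card * ((∏ k, w (f k)) * h f)) := by
        ring
    _ ≤ _ := by gcongr

/-- A bound over i.i.d. states transfers to arbitrarily varying states for permutation-invariant
tests. -/
lemma hsForm_tensorProdFam_symTest_le {C : Set (MatC ι)} (hC : Convex ℝ C)
    (hst : ∀ σ ∈ C, IsState σ) {s : Finset (MatC ι)} (hs : ↑s ⊆ C) {δ : ℝ} (hδ : 0 ≤ δ)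
    (hdom : ∀ σ ∈ C, ∃ τ ∈ s, σ ≤ (1 + δ) • τ) {E : MatN ι n} (hE : 0 ≤ E) {b : ℝ}
    (hn : 0 < n) (hb : ∀ σ ∈ C, hsForm (tensorPow σ n) E ≤ b)
    {f : Fin n → MatC ι} (hf : ∀ k, f k ∈ C) :
    hsForm (tensorProdFam f) (symTest E) ≤
      (1 + δ) ^ n * ((Real.exp 1 * (n + 1)) ^ s.card * b) := by
  choose τ hτs hτ using fun k => hdom (f k) (hf k)
  have hstep : tensorProdFam f ≤ (1 + δ) ^ n • tensorProdFam τ := by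
    rw [← tensorProdFam_smul]
    exact tensorProdFam_mono (fun k => (hst _ (hf k)).nonneg) hτ
  have h1 := hsForm_mono_left hstep (symTest_nonneg hE)
  rw [map_smul, LinearMap.smul_apply, smul_eq_mul] at h1
  refine h1.trans (mul_le_mul_of_nonneg_left ?_ (by positivity))
  have h2 := hsForm_tensorProdFam_comp_le (J := s) (τ := fun j => (j : MatC ι))
    (fun j => (hst _ (hs j.2)).nonneg) (fun k => ⟨τ k, hτs k⟩) hE
  rw [hsForm_tensorPow_symTest, Fintype.card_coe] at h2
  refine h2.trans (mul_le_mul_of_nonneg_left (hb _ ?_) (by positivity))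
  refine hC.sum_mem (fun j _ => by positivity) ?_ fun j _ => hs j.2
  rw [← Finset.sum_div, div_eq_one_iff_eq (by positivity), ← Nat.cast_sum, Nat.cast_inj]
  have := Finset.card_eq_sum_card_fiberwise (f := fun k : Fin n => (⟨τ k, hτs k⟩ : s))
    (s := Finset.univ) (t := Finset.univ) (by simp)
  simpa using this.symm

end Types

section Mixture

open scoped MatrixOrder Matrix.Norms.L2Operator NNReal

lemma nonneg_of_hsForm_nonneg {κ : Type*} [Fintype κ] {A : Matrix κ κ ℂ} (hA : A.IsHermitian)
    (h : ∀ E : Matrix κ κ ℂ, 0 ≤ E → 0 ≤ hsForm A E) : 0 ≤ A := by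
  rw [Matrix.nonneg_iff_posSemidef]
  refine Matrix.PosSemidef.of_dotProduct_mulVec_nonneg hA fun x => ?_
  have h1 := h _ (Matrix.nonneg_iff_posSemidef.2 (Matrix.posSemidef_vecMulVec_self_star x))
  have h2 : (A * Matrix.vecMulVec x (star x)).trace = star x ⬝ᵥ A.mulVec x := by
    rw [Matrix.mul_vecMulVec, Matrix.trace_vecMulVec, dotProduct_comm]
  rw [hsForm_apply, h2] at h1
  have h3 := hA.im_star_dotProduct_mulVec_self x
  exact Complex.nonneg_iff.2 ⟨h1, h3.symm⟩

variable {ι : Type*} [Fintype ι] [DecidableEq ι] {C : Set (MatC ι)} {n m : ℕ}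

instance : MeasurableSingletonClass (MatC ι) :=
  inferInstanceAs (MeasurableSingletonClass (ι → ι → ℂ))

lemma integrable_tensorPow_apply (hst : ∀ σ ∈ C, IsState σ) (μ : Measure ↥C) [IsFiniteMeasure μ]
    (i j : Fin n → ι) : Integrable (fun σ : ↥C => tensorPow (σ : MatC ι) n i j) μ := by
  refine Integrable.of_bound (C := ‖(Matrix.entryLinearMap ℝ ℂ i j).toContinuousLinearMap‖)
    (Measurable.aestronglyMeasurable ?_) (Eventually.of_forall fun σ => ?_)
  · refine Finset.measurable_fun_prod _ fun k _ => ?_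
    exact (measurable_pi_apply (j k)).comp ((measurable_pi_apply (i k)).comp measurable_subtype_coe)
  · refine ((Matrix.entryLinearMap ℝ ℂ i j).toContinuousLinearMap.le_opNorm
      (tensorPow (σ : MatC ι) n)).trans ?_
    exact mul_le_of_le_one_right (norm_nonneg _) (isState_tensorPow (hst σ σ.2) n).norm_le_one

lemma linearMap_eq_sum_apply {κ : Type*} [Fintype κ] [DecidableEq κ]
    (L : Matrix κ κ ℂ →ₗ[ℝ] ℝ) (A : Matrix κ κ ℂ) :
    L A = ∑ i, ∑ j, (L ∘ₗ Matrix.singleLinearMap ℝ i j) (A i j) := by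
  conv_lhs => rw [Matrix.matrix_eq_sum_single A]
  simp only [map_sum]
  rfl

lemma integrable_linearMap_tensorPow (hst : ∀ σ ∈ C, IsState σ) (μ : Measure ↥C)
    [IsFiniteMeasure μ] (L : MatN ι n →ₗ[ℝ] ℝ) :
    Integrable (fun σ : ↥C => L (tensorPow (σ : MatC ι) n)) μ := by
  simp only [linearMap_eq_sum_apply L]
  exact integrable_finsetSum _ fun i _ => integrable_finsetSum _ fun j _ =>
    (L ∘ₗ Matrix.singleLinearMap ℝ i j).toContinuousLinearMap.integrable_comp
      (integrable_tensorPow_apply hst μ i j)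

lemma linearMap_iidMix (hst : ∀ σ ∈ C, IsState σ) (μ : Measure ↥C) [IsFiniteMeasure μ]
    (L : MatN ι n →ₗ[ℝ] ℝ) :
    L (iidMix μ n) = ∫ σ : ↥C, L (tensorPow (σ : MatC ι) n) ∂μ := by
  have hint : ∀ i j, Integrable (fun σ : ↥C =>
      (L ∘ₗ Matrix.singleLinearMap ℝ i j) (tensorPow (σ : MatC ι) n i j)) μ := fun i j =>
    (L ∘ₗ Matrix.singleLinearMap ℝ i j).toContinuousLinearMap.integrable_comp
      (integrable_tensorPow_apply hst μ i j)
  simp only [linearMap_eq_sum_apply L]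
  rw [integral_finsetSum _ fun i _ => integrable_finsetSum _ fun j _ => hint i j]
  refine Finset.sum_congr rfl fun i _ => ?_
  rw [integral_finsetSum _ fun j _ => hint i j]
  refine Finset.sum_congr rfl fun j _ => ?_
  exact ((L ∘ₗ Matrix.singleLinearMap ℝ i j).toContinuousLinearMap.integral_comp_comm
    (integrable_tensorPow_apply hst μ i j)).symm

lemma integrable_hsForm_tensorPow (hst : ∀ σ ∈ C, IsState σ) (μ : Measure ↥C) [IsFiniteMeasure μ]
    (E : MatN ι n) : Integrable (fun σ : ↥C => hsForm (tensorPow (σ : MatC ι) n) E) μ :=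
  integrable_linearMap_tensorPow hst μ ((hsForm (κ := Fin n → ι)).flip E)

lemma hsForm_iidMix (hst : ∀ σ ∈ C, IsState σ) (μ : Measure ↥C) [IsFiniteMeasure μ]
    (E : MatN ι n) :
    hsForm (iidMix μ n) E = ∫ σ : ↥C, hsForm (tensorPow (σ : MatC ι) n) E ∂μ :=
  linearMap_iidMix hst μ ((hsForm (κ := Fin n → ι)).flip E)

lemma hsForm_tensorPow_nonneg (hst : ∀ σ ∈ C, IsState σ) (σ : ↥C) {E : MatN ι n} (hE : 0 ≤ E) :
    0 ≤ hsForm (tensorPow (σ : MatC ι) n) E := by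
  have h0 : 0 ≤ tensorPow (σ : MatC ι) n := tensorPow_nonneg (hst σ σ.2).nonneg n
  exact hsForm_nonneg h0 hE

lemma isHermitian_iidMix (hst : ∀ σ ∈ C, IsState σ) (μ : Measure ↥C) :
    (iidMix μ n).IsHermitian := by
  ext i j
  rw [Matrix.conjTranspose_apply, iidMix, iidMix, Complex.star_def, ← integral_conj]
  refine integral_congr_ae (Eventually.of_forall fun σ => ?_)
  exact (isState_tensorPow (hst σ σ.2) n).1.isHermitian.apply i j

lemma isState_iidMix (hst : ∀ σ ∈ C, IsState σ) (μ : Measure ↥C) [IsProbabilityMeasure μ] (n : ℕ) :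
    IsState (iidMix μ n) := by
  refine ⟨Matrix.nonneg_iff_posSemidef.1 (nonneg_of_hsForm_nonneg (isHermitian_iidMix hst μ)
    fun E hE => ?_), ?_⟩
  · rw [hsForm_iidMix hst μ E]
    exact integral_nonneg fun σ => hsForm_tensorPow_nonneg hst σ hE
  · have h : ∫ σ : ↥C, (tensorPow (σ : MatC ι) n).trace ∂μ = (iidMix μ n).trace :=
      integral_finsetSum _ fun i _ => integrable_tensorPow_apply hst μ i i
    rw [← h]
    simp [fun σ : ↥C => (isState_tensorPow (hst σ σ.2) n).2]

lemma hsForm_iidMix_le (hst : ∀ σ ∈ C, IsState σ) (μ : Measure ↥C) [IsProbabilityMeasure μ]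
    {E : MatN ι n} {b : ℝ} (h : ∀ σ ∈ C, hsForm (tensorPow σ n) E ≤ b) :
    hsForm (iidMix μ n) E ≤ b := by
  rw [hsForm_iidMix hst μ E]
  exact (integral_mono (integrable_hsForm_tensorPow hst μ E) (integrable_const b)
    fun σ => h σ σ.2).trans_eq (by simp)

lemma smul_tensorPow_le_iidMix (hst : ∀ σ ∈ C, IsState σ) (μ : Measure ↥C)
    [IsProbabilityMeasure μ] (τ : ↥C) (n : ℕ) :
    μ.real {τ} • tensorPow (τ : MatC ι) n ≤ iidMix μ n := by
  have hτ := isState_tensorPow (hst τ τ.2) n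
  rw [← sub_nonneg]
  refine nonneg_of_hsForm_nonneg ?_ fun E hE => ?_
  · exact (isHermitian_iidMix hst μ).sub
      ((IsSelfAdjoint.all (μ.real {τ})).smul hτ.1.isHermitian.isSelfAdjoint)
  · rw [map_sub, LinearMap.sub_apply, hsForm_iidMix hst μ E, map_smul, LinearMap.smul_apply,
      sub_nonneg]
    have h1 := setIntegral_le_integral (s := {τ}) (integrable_hsForm_tensorPow hst μ E)
      (Eventually.of_forall fun σ => hsForm_tensorPow_nonneg hst σ hE)
    rwa [integral_singleton] at h1

lemma exists_pos_measure_singleton {α : Type*} [MeasurableSpace α] [MeasurableSingletonClass α]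
    {s : Set α} (hs : s.Countable) (hne : s.Nonempty) :
    ∃ μ : Measure α, IsProbabilityMeasure μ ∧ ∀ x ∈ s, 0 < μ.real {x} := by
  obtain ⟨c, rfl⟩ := hs.exists_eq_range hne
  have hc : Measurable c := measurable_of_countable c
  refine ⟨(ProbabilityTheory.poissonMeasure 1).map c, Measure.isProbabilityMeasure_map
    hc.aemeasurable, ?_⟩
  rintro _ ⟨i, rfl⟩
  rw [map_measureReal_apply hc (measurableSet_singleton _)]
  exact (ProbabilityTheory.poissonMeasure_real_singleton_pos i one_pos).trans_le
    (measureReal_mono (by simp))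

/-- A convex set of states carries a mixture dominating every i.i.d. state up to a subexponential
factor. -/
lemma exists_universal_measure (hC : Convex ℝ C) (hne : C.Nonempty) (hst : ∀ σ ∈ C, IsState σ) :
    ∃ μ : Measure ↥C, IsProbabilityMeasure μ ∧ ∀ δ : ℝ, 0 < δ → ∃ c : ℝ, 0 < c ∧
      ∀ n : ℕ, ∀ σ ∈ C, tensorPow σ n ≤ (c * (1 + δ) ^ n) • iidMix μ n := by
  choose s hsC hs using fun m : ℕ =>
    exists_finset_dominating hC hne hst (δ := 1 / ((m : ℝ) + 1)) (by positivity)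
  set S : Set ↥C := ⋃ m, Subtype.val ⁻¹' (s m : Set (MatC ι))
  have hScount : S.Countable := Set.countable_iUnion fun m =>
    (s m).countable_toSet.preimage Subtype.val_injective
  have hSne : S.Nonempty := by
    obtain ⟨σ, hσ⟩ := hne
    obtain ⟨τ, hτ, -⟩ := hs 0 σ hσ
    exact ⟨⟨τ, hsC 0 hτ⟩, Set.mem_iUnion.2 ⟨0, hτ⟩⟩
  obtain ⟨μ, hμ, hpos⟩ := exists_pos_measure_singleton hScount hSne
  refine ⟨μ, hμ, fun δ hδ => ?_⟩
  obtain ⟨m, hm⟩ := exists_nat_one_div_lt hδ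
  have hsum : ∀ τ ∈ (s m).attach, 0 ≤ (μ.real {(⟨τ, hsC m τ.2⟩ : ↥C)})⁻¹ := fun τ _ => by
    positivity
  refine ⟨1 + ∑ τ ∈ (s m).attach, (μ.real {(⟨τ, hsC m τ.2⟩ : ↥C)})⁻¹, by
    linarith [Finset.sum_nonneg hsum], fun n σ hσ => ?_⟩
  obtain ⟨τ, hτ, hle⟩ := hs m σ hσ
  set p := μ.real {(⟨τ, hsC m hτ⟩ : ↥C)} with hp
  have hp0 : 0 < p := hpos _ (Set.mem_iUnion.2 ⟨m, hτ⟩)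
  have hτ0 : 0 ≤ tensorPow τ n := tensorPow_nonneg (hst τ (hsC m hτ)).nonneg n
  have hω0 : 0 ≤ iidMix μ n := (isState_iidMix hst μ n).nonneg
  have h1 : tensorPow τ n ≤ p⁻¹ • iidMix μ n := by
    have := smul_le_smul_of_nonneg_left (smul_tensorPow_le_iidMix hst μ ⟨τ, hsC m hτ⟩ n)
      (inv_nonneg.2 hp0.le)
    rwa [smul_smul, inv_mul_cancel₀ hp0.ne', one_smul] at this
  calc tensorPow σ n ≤ (1 + 1 / ((m : ℝ) + 1)) ^ n • tensorPow τ n := by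
        rw [← tensorPow_smul]
        exact tensorPow_mono (hst σ hσ).nonneg hle n
    _ ≤ (1 + δ) ^ n • tensorPow τ n := by gcongr
    _ ≤ (1 + δ) ^ n • p⁻¹ • iidMix μ n := by gcongr
    _ = (p⁻¹ * (1 + δ) ^ n) • iidMix μ n := by rw [smul_smul, mul_comm]
    _ ≤ _ := by
      gcongr
      have := Finset.single_le_sum hsum (Finset.mem_attach (s m) ⟨τ, hτ⟩)
      linarith

/-- Domination of i.i.d. states by the mixture makes it submultiplicative. -/
lemma iidMix_add_le (hst : ∀ σ ∈ C, IsState σ) (μ : Measure ↥C) [IsProbabilityMeasure μ]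
    {K : ℝ} (h : ∀ σ ∈ C, tensorPow σ m ≤ K • iidMix μ m) :
    iidMix μ (n + m) ≤ K • tensorMul (iidMix μ n) (iidMix μ m) := by
  have hn0 := (isState_iidMix hst μ n).nonneg
  have hm0 := (isState_iidMix hst μ m).nonneg
  rw [← sub_nonneg]
  refine nonneg_of_hsForm_nonneg ?_ fun E hE => ?_
  · have h1 := (Matrix.nonneg_iff_posSemidef.1 (tensorMul_nonneg hn0 hm0)).isHermitian
    exact Matrix.IsHermitian.sub ((IsSelfAdjoint.all K).smul h1.isSelfAdjoint)
      (isHermitian_iidMix hst μ)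
  · have h1 := linearMap_iidMix hst μ ((hsForm (κ := Fin (n + m) → ι)).flip E)
    have h2 := linearMap_iidMix hst μ
      (K • ((hsForm (κ := Fin (n + m) → ι)).flip E) ∘ₗ (tensorBilin ι n m).flip (iidMix μ m))
    rw [LinearMap.flip_apply] at h1
    have h3 : hsForm (K • tensorMul (iidMix μ n) (iidMix μ m)) E =
        (K • ((hsForm (κ := Fin (n + m) → ι)).flip E) ∘ₗ (tensorBilin ι n m).flip (iidMix μ m))
          (iidMix μ n) := by
      rw [map_smul]; rfl
    rw [map_sub, LinearMap.sub_apply, sub_nonneg, h3, h1, h2]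
    refine integral_mono (integrable_linearMap_tensorPow hst μ _)
      (integrable_linearMap_tensorPow hst μ _) fun σ => ?_
    have h4 : tensorPow (σ : MatC ι) (n + m) ≤
        K • tensorMul (tensorPow (σ : MatC ι) n) (iidMix μ m) := by
      rw [← tensorMul_tensorPow]
      refine (tensorMul_mono_right (tensorPow_nonneg (hst σ σ.2).nonneg n) (h σ σ.2)).trans_eq ?_
      rw [← tensorBilin_apply, map_smul]; rfl
    refine (hsForm_mono_left h4 hE).trans_eq ?_
    rw [map_smul]; rfl

end Mixture

section Exponents

set_option linter.unusedSectionVars false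

open scoped MatrixOrder Matrix.Norms.L2Operator NNReal

lemma le_cFrac_mul_iff {n : ℕ} (hn : 0 < n) (r : ℝ) (x : EReal) :
    (r : EReal) ≤ cFrac n * x ↔ ((n * r : ℝ) : EReal) ≤ x := by
  have hn' : (0 : ℝ) < n := Nat.cast_pos.2 hn
  unfold cFrac
  induction x with
  | bot => rw [EReal.coe_mul_bot_of_pos (inv_pos.2 hn')]; simp only [le_bot_iff, EReal.coe_ne_bot]
  | top => rw [EReal.coe_mul_top_of_pos (inv_pos.2 hn')]; simp
  | coe x => rw [← EReal.coe_mul, EReal.coe_le_coe_iff, EReal.coe_le_coe_iff, le_inv_mul_iff₀ hn']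

lemma lt_cFrac_mul_iff {n : ℕ} (hn : 0 < n) (r : ℝ) (x : EReal) :
    (r : EReal) < cFrac n * x ↔ ((n * r : ℝ) : EReal) < x := by
  have hn' : (0 : ℝ) < n := Nat.cast_pos.2 hn
  unfold cFrac
  induction x with
  | bot => rw [EReal.coe_mul_bot_of_pos (inv_pos.2 hn')]; simp
  | top => rw [EReal.coe_mul_top_of_pos (inv_pos.2 hn')]; simp only [EReal.coe_lt_top]
  | coe x => rw [← EReal.coe_mul, EReal.coe_lt_coe_iff, EReal.coe_lt_coe_iff, lt_inv_mul_iff₀ hn']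

lemma le_negLog_iff (r x : ℝ) : (r : EReal) ≤ negLog x ↔ x ≤ Real.exp (-r) := by
  unfold negLog
  split_ifs with h
  · simp [h.trans (Real.exp_pos _).le]
  · rw [EReal.coe_le_coe_iff, le_neg, Real.log_le_iff_le_exp (not_le.1 h)]

lemma lt_negLog_iff (r x : ℝ) : (r : EReal) < negLog x ↔ x < Real.exp (-r) := by
  unfold negLog
  split_ifs with h
  · simp [h.trans_lt (Real.exp_pos _), EReal.coe_lt_top]
  · rw [EReal.coe_lt_coe_iff, lt_neg, Real.log_lt_iff_lt_exp (not_le.1 h)]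

section Tests

variable {κ : Type*} [Fintype κ] [DecidableEq κ] {A B : Set (Matrix κ κ ℂ)} {ε b : ℝ}

lemma typeII_le (hB : ∀ σ ∈ B, IsState σ) (hne : B.Nonempty) {E : Matrix κ κ ℂ} (hE0 : 0 ≤ E)
    (hE1 : E ≤ 1) (hA : ∀ ρ ∈ A, hsForm ρ (1 - E) ≤ ε) (hb : ∀ σ ∈ B, hsForm σ E ≤ b) :
    typeII A B ε ≤ b := by
  unfold typeII
  refine csInf_le_of_le ⟨0, ?_⟩ ⟨E, Matrix.nonneg_iff_posSemidef.1 hE0, hE1, hA, rfl⟩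
    (csSup_le ?_ ?_)
  · rintro _ ⟨F, hF, -, -, rfl⟩
    refine Real.sSup_nonneg ?_
    rintro _ ⟨σ, hσ, rfl⟩
    exact hsForm_nonneg (hB σ hσ).nonneg (Matrix.nonneg_iff_posSemidef.2 hF)
  · obtain ⟨σ, hσ⟩ := hne
    exact ⟨_, σ, hσ, rfl⟩
  · rintro _ ⟨σ, hσ, rfl⟩
    exact hb σ hσ

lemma exists_test_of_typeII_lt (hB : ∀ σ ∈ B, IsState σ) (hε : 0 ≤ ε) (h : typeII A B ε < b) :
    ∃ E : Matrix κ κ ℂ, 0 ≤ E ∧ E ≤ 1 ∧ (∀ ρ ∈ A, hsForm ρ (1 - E) ≤ ε) ∧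
      ∀ σ ∈ B, hsForm σ E ≤ b := by
  have hne : {b : ℝ | ∃ E : Matrix κ κ ℂ, E.PosSemidef ∧ (1 - E).PosSemidef ∧
      (∀ ρ ∈ A, (ρ * (1 - E)).trace.re ≤ ε) ∧
      b = sSup {x : ℝ | ∃ σ ∈ B, x = (σ * E).trace.re}}.Nonempty :=
    ⟨_, 1, Matrix.PosSemidef.one, by simp [Matrix.PosSemidef.zero], by simpa using fun _ _ => hε,
      rfl⟩
  obtain ⟨_, ⟨E, hE0, hE1, hA, rfl⟩, hlt⟩ := exists_lt_of_csInf_lt hne h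
  refine ⟨E, Matrix.nonneg_iff_posSemidef.2 hE0, hE1, hA, fun σ hσ => ?_⟩
  refine le_trans ?_ hlt.le
  refine le_csSup ⟨1, ?_⟩ ⟨σ, hσ, rfl⟩
  rintro _ ⟨τ, hτ, rfl⟩
  exact hsForm_le_one (hB τ hτ) hE1

end Tests

variable {ι : Type*} [Fintype ι] [DecidableEq ι] {A B B' : ∀ n : ℕ, Set (MatN ι n)}

/-- Tests with vanishing type I error achieve type II error decaying at rate `r`. -/
def Achievable (A B : ∀ n : ℕ, Set (MatN ι n)) (r : ℝ) : Prop :=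
  ∀ ε ∈ Set.Ioo (0 : ℝ) 1, ∀ᶠ n : ℕ in atTop, ∃ E : MatN ι n, 0 ≤ E ∧ E ≤ 1 ∧
    (∀ ρ ∈ A n, hsForm ρ (1 - E) ≤ ε) ∧ ∀ σ ∈ B n, hsForm σ E ≤ Real.exp (-(n * r))

lemma Achievable.le_steinExponent (hB : ∀ n, ∀ σ ∈ B n, IsState σ) (hne : ∀ n, (B n).Nonempty)
    {r : ℝ} (h : Achievable A B r) : (r : EReal) ≤ steinExponent A B := by
  refine le_iInf₂ fun ε hε => le_liminf_of_le (by isBoundedDefault) ?_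
  filter_upwards [h ε hε, eventually_gt_atTop 0] with n ⟨E, hE0, hE1, hEA, hEB⟩ hn
  rw [le_cFrac_mul_iff hn, le_negLog_iff]
  exact typeII_le (hB n) (hne n) hE0 hE1 hEA hEB

lemma achievable_of_lt_steinExponent (hB : ∀ n, ∀ σ ∈ B n, IsState σ) {r : ℝ}
    (h : (r : EReal) < steinExponent A B) : Achievable A B r := by
  intro ε hε
  have h1 := eventually_lt_of_lt_liminf (h.trans_le (iInf₂_le ε hε))
  filter_upwards [h1, eventually_gt_atTop 0] with n hn hn0
  rw [lt_cFrac_mul_iff hn0, lt_negLog_iff] at hn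
  exact exists_test_of_typeII_lt (hB n) hε.1.le hn

lemma steinExponent_le_of_achievable (hB : ∀ n, ∀ σ ∈ B n, IsState σ)
    (hB' : ∀ n, ∀ σ ∈ B' n, IsState σ) (hne : ∀ n, (B' n).Nonempty)
    (h : ∀ r r' : ℝ, r' < r → Achievable A B r → Achievable A B' r') :
    steinExponent A B ≤ steinExponent A B' := by
  refine EReal.ge_of_forall_gt_iff_ge.1 fun z hz => ?_
  obtain ⟨z', hz', hlt⟩ := EReal.lt_iff_exists_real_btwn.1 hz
  exact (h z' z (EReal.coe_lt_coe_iff.1 hz')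
    (achievable_of_lt_steinExponent hB hlt)).le_steinExponent hB' hne

lemma steinExponent_anti_right (hB : ∀ n, ∀ σ ∈ B n, IsState σ) (hne : ∀ n, (B' n).Nonempty)
    (h : ∀ n, B' n ⊆ B n) : steinExponent A B ≤ steinExponent A B' := by
  refine steinExponent_le_of_achievable hB (fun n σ hσ => hB n σ (h n hσ)) hne
    fun r r' hr hA ε hε => ?_
  filter_upwards [hA ε hε] with n ⟨E, hE0, hE1, hEA, hEB⟩
  refine ⟨E, hE0, hE1, hEA, fun σ hσ => (hEB σ (h n hσ)).trans ?_⟩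
  gcongr

variable {A1 B1 C : Set (MatC ι)}

lemma isState_of_mem_convexHull (hB : ∀ σ ∈ B1, IsState σ) : ∀ σ ∈ convexHull ℝ B1, IsState σ := by
  have hconv : Convex ℝ {σ : MatC ι | IsState σ} := by
    intro σ hσ τ hτ a b ha hb hab
    refine ⟨Matrix.nonneg_iff_posSemidef.1 (add_nonneg (smul_nonneg ha hσ.nonneg)
      (smul_nonneg hb hτ.nonneg)), ?_⟩
    rw [Matrix.trace_add, Matrix.trace_smul, Matrix.trace_smul, hσ.2, hτ.2, ← add_smul, hab,
      one_smul]
  exact fun σ hσ => convexHull_min hB hconv hσ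

lemma isState_of_mem_iidSet (hC : ∀ σ ∈ C, IsState σ) (n : ℕ) : ∀ σ ∈ iidSet C n, IsState σ := by
  rintro _ ⟨σ, hσ, rfl⟩
  exact isState_tensorPow (hC σ hσ) n

lemma isState_of_mem_avSet (hC : ∀ σ ∈ C, IsState σ) (n : ℕ) : ∀ σ ∈ avSet C n, IsState σ := by
  rintro _ ⟨f, hf, rfl⟩
  exact isState_tensorProdFam fun k => hC _ (hf k)

lemma iidSet_nonempty (hC : C.Nonempty) (n : ℕ) : (iidSet C n).Nonempty :=
  let ⟨σ, hσ⟩ := hC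
  ⟨_, σ, hσ, rfl⟩

lemma iidSet_subset_avSet (C : Set (MatC ι)) (n : ℕ) : iidSet C n ⊆ avSet C n := by
  rintro _ ⟨σ, hσ, rfl⟩
  exact ⟨fun _ => σ, fun _ => hσ, rfl⟩

lemma avSet_nonempty (hC : C.Nonempty) (n : ℕ) : (avSet C n).Nonempty :=
  (iidSet_nonempty hC n).mono (iidSet_subset_avSet C n)

lemma steinExponent_avSet_convexHull (hB : ∀ σ ∈ B1, IsState σ) (hne : B1.Nonempty) :
    steinExponent A (avSet (convexHull ℝ B1)) = steinExponent A (avSet B1) := by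
  have hC := isState_of_mem_convexHull hB
  refine le_antisymm (steinExponent_anti_right (isState_of_mem_avSet hC) (avSet_nonempty hne) ?_) ?_
  · rintro n _ ⟨f, hf, rfl⟩
    exact ⟨f, fun k => subset_convexHull ℝ B1 (hf k), rfl⟩
  · refine steinExponent_le_of_achievable (isState_of_mem_avSet hB) (isState_of_mem_avSet hC)
      (avSet_nonempty hne.convexHull) fun r r' hr hA ε hε => ?_
    filter_upwards [hA ε hε] with n ⟨E, hE0, hE1, hEA, hEB⟩
    refine ⟨E, hE0, hE1, hEA, ?_⟩
    rintro _ ⟨f, hf, rfl⟩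
    refine (hsForm_tensorProdFam_le_of_convexHull (fun g hg => hEB _ ⟨g, hg, rfl⟩) hf).trans ?_
    gcongr

lemma eventually_mul_pow_le_exp (K : ℝ) (k : ℕ) {c : ℝ} (hc : 0 < c) :
    ∀ᶠ n : ℕ in atTop, K * ((n : ℝ) + 1) ^ k ≤ Real.exp (n * c) := by
  have h1 : ∀ᶠ x : ℝ in atTop, ‖K * x ^ k‖ ≤ Real.exp (-c) * ‖Real.exp (c * x)‖ :=
    ((isLittleO_pow_exp_pos_mul_atTop k hc).const_mul_left K).def (Real.exp_pos _)
  have h2 : Tendsto (fun n : ℕ => (n : ℝ) + 1) atTop atTop :=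
    tendsto_atTop_add_const_right _ _ tendsto_natCast_atTop_atTop
  filter_upwards [h2.eventually h1] with n hn
  refine (le_abs_self _).trans (hn.trans_eq ?_)
  rw [Real.norm_eq_abs, Real.abs_exp, ← Real.exp_add]
  congr 1
  ring

lemma exists_pos_log_one_add_lt {c : ℝ} (hc : 0 < c) : ∃ δ : ℝ, 0 < δ ∧ 1 + δ < Real.exp c :=
  ⟨(Real.exp c - 1) / 2, by linarith [Real.one_lt_exp_iff.2 hc], by
    linarith [Real.one_lt_exp_iff.2 hc]⟩

lemma steinExponent_iidSet_avSet (hC : Convex ℝ C) (hst : ∀ σ ∈ C, IsState σ) (hne : C.Nonempty) :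
    steinExponent (iidSet A1) (iidSet C) = steinExponent (iidSet A1) (avSet C) := by
  refine le_antisymm ?_ (steinExponent_anti_right (isState_of_mem_avSet hst) (iidSet_nonempty hne)
    (iidSet_subset_avSet C))
  refine steinExponent_le_of_achievable (isState_of_mem_iidSet hst) (isState_of_mem_avSet hst)
    (avSet_nonempty hne) fun r r' hr hA ε hε => ?_
  have hc : 0 < (r - r') / 2 := by linarith
  obtain ⟨δ, hδ, hδc⟩ := exists_pos_log_one_add_lt hc
  obtain ⟨s, hsC, hs⟩ := exists_finset_dominating hC hne hst hδ
  filter_upwards [hA ε hε, eventually_gt_atTop 0,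
    eventually_mul_pow_le_exp (Real.exp 1 ^ s.card) s.card hc]
    with n ⟨E, hE0, hE1, hEA, hEB⟩ hn hexp
  refine ⟨symTest E, symTest_nonneg hE0, ?_, ?_, ?_⟩
  · rw [← sub_nonneg, one_sub_symTest]
    exact symTest_nonneg (sub_nonneg.2 hE1)
  · rintro _ ⟨ρ, hρ, rfl⟩
    rw [one_sub_symTest, hsForm_tensorPow_symTest]
    exact hEA _ ⟨ρ, hρ, rfl⟩
  · rintro _ ⟨f, hf, rfl⟩
    have h1 := hsForm_tensorProdFam_symTest_le hC hst hsC hδ.le hs hE0 hn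
      (fun σ hσ => hEB _ ⟨σ, hσ, rfl⟩) hf
    refine h1.trans ?_
    rw [mul_pow]
    calc (1 + δ) ^ n * (Real.exp 1 ^ s.card * ((n : ℝ) + 1) ^ s.card * Real.exp (-(n * r)))
        ≤ Real.exp ((r - r') / 2) ^ n * (Real.exp (n * ((r - r') / 2)) * Real.exp (-(n * r))) := by
          gcongr
      _ = Real.exp (-(n * r')) := by
          rw [← Real.exp_nat_mul, ← Real.exp_add, ← Real.exp_add]
          congr 1
          ring

/-- Weak converse: the regularised relative entropy to an i.i.d. mixture is at least the Stein
exponent. -/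
lemma eventually_le_cFrac_mul_relEnt (hA : ∀ ρ ∈ A1, IsState ρ) (hst : ∀ σ ∈ C, IsState σ)
    {r : ℝ} (hr : (r : EReal) < steinExponent (iidSet A1) (iidSet C)) {ρ : MatC ι} (hρ : ρ ∈ A1)
    (μ : Measure ↥C) [IsProbabilityMeasure μ] :
    ∀ᶠ n : ℕ in atTop, (r : EReal) ≤ cFrac n * relEnt (tensorPow ρ n) (iidMix μ n) := by
  rcases lt_or_ge r 0 with hr0 | hr0
  · filter_upwards [eventually_gt_atTop 0] with n hn
    rw [le_cFrac_mul_iff hn]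
    refine le_trans ?_ (relEnt_nonneg (isState_tensorPow (hA ρ hρ) n) (isState_iidMix hst μ n))
    exact_mod_cast mul_nonpos_of_nonneg_of_nonpos (Nat.cast_nonneg n) hr0.le
  obtain ⟨r', hrr', hr'⟩ := EReal.lt_iff_exists_real_btwn.1 hr
  replace hrr' : r < r' := EReal.coe_lt_coe_iff.1 hrr'
  obtain ⟨a, hra, har'⟩ := exists_between hrr'
  have ha : 0 < a := hr0.trans_lt hra
  have hg : 0 < 1 - r / a := by rw [sub_pos, div_lt_one ha]; exact hra
  have hg1 : 1 - r / a ≤ 1 := by linarith [div_nonneg hr0 ha.le]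
  have hach := achievable_of_lt_steinExponent (isState_of_mem_iidSet hst) hr'
    ((1 - r / a) / 8) ⟨by linarith, by linarith⟩
  have hlim1 : Tendsto (fun n : ℕ => 1 / a / (n : ℝ)) atTop (𝓝 0) :=
    tendsto_const_div_atTop_nhds_zero_nat _
  filter_upwards [hach, eventually_gt_atTop 0, hlim1.eventually_lt_const (half_pos hg),
    eventually_mul_pow_le_exp (8 / (1 - r / a)) 0 (sub_pos.2 har')]
    with n ⟨E, hE0, hE1, hEA, hEB⟩ hn hn1 hn2
  have hn' : (0 : ℝ) < n := Nat.cast_pos.2 hn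
  rw [le_cFrac_mul_iff hn]
  by_contra hlt
  have h1 := relEnt_test_bound (isState_tensorPow (hA ρ hρ) n) (isState_iidMix hst μ n) hE0 hE1
    (mul_pos hn' ha) (not_le.1 hlt).le
  have h2 : hsForm (tensorPow ρ n) (1 - E) ≤ (1 - r / a) / 8 := hEA _ ⟨ρ, hρ, rfl⟩
  have h3 : hsForm (iidMix μ n) E ≤ Real.exp (-(n * r')) :=
    hsForm_iidMix_le hst μ fun σ hσ => hEB _ ⟨σ, hσ, rfl⟩
  have h4 : Real.exp (n * a) * hsForm (iidMix μ n) E ≤ (1 - r / a) / 8 := by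
    calc Real.exp (n * a) * hsForm (iidMix μ n) E
        ≤ Real.exp (n * a) * Real.exp (-(n * r')) := by gcongr
      _ = (Real.exp (n * (r' - a)))⁻¹ := by rw [← Real.exp_add, ← Real.exp_neg]; congr 1; ring
      _ ≤ (8 / (1 - r / a))⁻¹ := by
        gcongr
        simpa using hn2
      _ = (1 - r / a) / 8 := inv_div _ _
  have h5 : (n * r + 1) / (n * a) = r / a + 1 / a / n := by field_simp
  rw [h5] at h1
  linarith

end Exponents

section Decay
open scoped MatrixOrder Matrix.Norms.L2Operator NNReal

variable {ι : Type*} [Fintype ι] [DecidableEq ι] {n m : ℕ} {C : Set (MatC ι)}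

/-- A measure is universal for `C` if its mixtures dominate all powers of elements of `C` up to
subexponential factors. -/
def Universal (μ : Measure ↥C) : Prop :=
  ∀ γ : ℝ, 0 < γ → ∃ κ : ℝ, ∀ n : ℕ, ∀ σ ∈ C,
    tensorPow σ n ≤ Real.exp (κ + n * γ) • iidMix μ n

lemma exists_universal (hC : Convex ℝ C) (hne : C.Nonempty) (hst : ∀ σ ∈ C, IsState σ) :
    ∃ μ : Measure ↥C, IsProbabilityMeasure μ ∧ Universal μ := by
  obtain ⟨μ, hμ, h⟩ := exists_universal_measure hC hne hst
  refine ⟨μ, hμ, fun γ hγ => ?_⟩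
  obtain ⟨δ, hδ, hδγ⟩ := exists_pos_log_one_add_lt hγ
  obtain ⟨c, hc, hle⟩ := h δ hδ
  refine ⟨Real.log c, fun n σ hσ => (hle n σ hσ).trans ?_⟩
  have h0 : 0 ≤ iidMix μ n := (isState_iidMix hst μ n).nonneg
  refine smul_le_smul_of_nonneg_right ?_ h0
  rw [Real.exp_add, Real.exp_log hc, Real.exp_nat_mul]
  gcongr

lemma exp_smul_nnrpow_inv {κ : Type*} [Fintype κ] [DecidableEq κ] {A : Matrix κ κ ℂ} (hA : 0 ≤ A)
    (y : ℝ) (k : ℕ) :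
    (Real.exp y • A) ^ ((1 : ℝ≥0) / (k + 1)) =
      Real.exp (y / (k + 1)) • A ^ ((1 : ℝ≥0) / (k + 1)) := by
  have h0 : 0 ≤ A ^ ((1 : ℝ≥0) / (k + 1)) := CFC.nnrpow_nonneg
  have h1 : 0 ≤ Real.exp (y / (k + 1)) • A ^ ((1 : ℝ≥0) / (k + 1)) :=
    smul_nonneg (Real.exp_pos _).le h0
  have h2 := pow_succ_nnrpow_inv h1 k
  rw [smul_pow, nnrpow_inv_pow_succ hA, ← Real.exp_nat_mul] at h2
  rw [← h2]
  congr 3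
  push_cast
  field_simp

lemma tendsto_zero_of_le_mul {H : ℕ → ℝ} (h0 : ∀ n, 0 ≤ H n) {x : ℝ} (hx0 : 0 ≤ x) (hx : x < 1)
    (hm : 0 < m) (h : ∀ n, H (n + m) ≤ x * H n) : Tendsto H atTop (𝓝 0) := by
  set M := ∑ j ∈ Finset.range m, H j
  have hb : ∀ q j, j < m → H (j + q * m) ≤ x ^ q * M := by
    intro q
    induction q with
    | zero =>
      intro j hj
      simpa using Finset.single_le_sum (f := H) (fun i _ => h0 i) (Finset.mem_range.2 hj)
    | succ q ih =>
      intro j hj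
      calc H (j + (q + 1) * m) = H (j + q * m + m) := by ring_nf
        _ ≤ x * H (j + q * m) := h _
        _ ≤ x * (x ^ q * M) := by gcongr; exact ih j hj
        _ = x ^ (q + 1) * M := by ring
  have hlim : Tendsto (fun n : ℕ => x ^ (n / m) * M) atTop (𝓝 0) := by
    simpa using ((tendsto_pow_atTop_nhds_zero_of_lt_one hx0 hx).comp
      (Nat.tendsto_div_const_atTop hm.ne')).mul_const M
  refine squeeze_zero h0 (fun n => ?_) hlim
  have := hb (n / m) (n % m) (Nat.mod_lt n hm)
  rwa [Nat.mod_add_div'] at this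

/-- The exponentially weighted overlap `⟨(θ^{⊗n})^{k/(k+1)}, (iidMix μ n)^{1/(k+1)}⟩`. -/
def weightedOverlap (θ : MatC ι) (μ : Measure ↥C) (a : ℝ) (k n : ℕ) : ℝ :=
  Real.exp (n * a / (k + 1)) *
    hsForm (tensorPow θ n ^ ((k : ℝ≥0) / (k + 1))) (iidMix μ n ^ ((1 : ℝ≥0) / (k + 1)))

lemma hsForm_nnrpow_nonneg {κ : Type*} [Fintype κ] [DecidableEq κ] (A B : Matrix κ κ ℂ)
    (s t : ℝ≥0) : 0 ≤ hsForm (A ^ s) (B ^ t) := by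
  have hA : 0 ≤ A ^ s := CFC.nnrpow_nonneg
  have hB : 0 ≤ B ^ t := CFC.nnrpow_nonneg
  exact hsForm_nonneg hA hB

lemma weightedOverlap_add_le (hst : ∀ σ ∈ C, IsState σ) (μ : Measure ↥C) [IsProbabilityMeasure μ]
    {θ : MatC ι} (hθ : 0 ≤ θ) {a y : ℝ} {k : ℕ} (hk : 0 < k)
    (h : ∀ σ ∈ C, tensorPow σ m ≤ Real.exp y • iidMix μ m) :
    weightedOverlap θ μ a k (n + m) ≤
      Real.exp (y / (k + 1)) * weightedOverlap θ μ a k m * weightedOverlap θ μ a k n := by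
  have hn : 0 ≤ iidMix μ n := (isState_iidMix hst μ n).nonneg
  have hm : 0 ≤ iidMix μ m := (isState_iidMix hst μ m).nonneg
  have hnm : 0 ≤ tensorMul (iidMix μ n) (iidMix μ m) := tensorMul_nonneg hn hm
  have hθn : 0 ≤ tensorPow θ n := tensorPow_nonneg hθ n
  have hθm : 0 ≤ tensorPow θ m := tensorPow_nonneg hθ m
  have hs : ((1 : ℝ≥0) / (k + 1)) ∈ Set.Icc (0 : ℝ≥0) 1 :=
    ⟨zero_le, by rw [div_le_one (by positivity)]; simp⟩
  have h1 := CFC.nnrpow_le_nnrpow hs (iidMix_add_le (n := n) hst μ h)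
  rw [exp_smul_nnrpow_inv hnm, tensorMul_nnrpow_inv hn hm] at h1
  have hA : 0 ≤ tensorPow θ n ^ ((k : ℝ≥0) / (k + 1)) := CFC.nnrpow_nonneg
  have hA' : 0 ≤ tensorPow θ m ^ ((k : ℝ≥0) / (k + 1)) := CFC.nnrpow_nonneg
  have hB : 0 ≤ iidMix μ n ^ ((1 : ℝ≥0) / (k + 1)) := CFC.nnrpow_nonneg
  have hB' : 0 ≤ iidMix μ m ^ ((1 : ℝ≥0) / (k + 1)) := CFC.nnrpow_nonneg
  have hAA : 0 ≤ tensorMul (tensorPow θ n ^ ((k : ℝ≥0) / (k + 1)))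
    (tensorPow θ m ^ ((k : ℝ≥0) / (k + 1))) := tensorMul_nonneg hA hA'
  have h2 := hsForm_mono_right hAA h1
  rw [map_smul, smul_eq_mul, hsForm_tensorMul
    (Matrix.nonneg_iff_posSemidef.1 hA).isHermitian (Matrix.nonneg_iff_posSemidef.1 hB).isHermitian,
    ← tensorMul_nnrpow hθn hθm hk, tensorMul_tensorPow] at h2
  unfold weightedOverlap
  refine (mul_le_mul_of_nonneg_left h2 (Real.exp_pos _).le).trans_eq ?_
  have h3 : Real.exp (((n + m : ℕ) : ℝ) * a / (k + 1)) =
      Real.exp (n * a / (k + 1)) * Real.exp (m * a / (k + 1)) := by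
    rw [← Real.exp_add]; congr 1; push_cast; ring
  rw [h3]; ring

lemma exists_test_weightedOverlap (hst : ∀ σ ∈ C, IsState σ) (μ : Measure ↥C)
    [IsProbabilityMeasure μ] {θ : MatC ι} (hθ : 0 ≤ θ) (a : ℝ) {k : ℕ} (hk : 0 < k) (n : ℕ) :
    ∃ E : MatN ι n, 0 ≤ E ∧ E ≤ 1 ∧ hsForm (tensorPow θ n) (1 - E) ≤ weightedOverlap θ μ a k n ∧
      hsForm (iidMix μ n) E ≤ weightedOverlap θ μ a k n * Real.exp (-(n * a)) := by
  have hn : 0 ≤ iidMix μ n := (isState_iidMix hst μ n).nonneg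
  have hB : 0 ≤ Real.exp (n * a) • iidMix μ n := smul_nonneg (Real.exp_pos _).le hn
  have hA : 0 ≤ tensorPow θ n := tensorPow_nonneg hθ n
  have hk' : (0 : ℝ≥0) < k := by exact_mod_cast hk
  obtain ⟨E, hE0, hE1, hE⟩ := exists_test_le_nnrpow hA hB (s := (1 : ℝ≥0) / (k + 1))
    (t := (k : ℝ≥0) / (k + 1)) (by positivity) (by positivity) (by field_simp)
  rw [exp_smul_nnrpow_inv hn, map_smul, map_smul, LinearMap.smul_apply, smul_eq_mul,
    smul_eq_mul] at hE
  have h1 : 0 ≤ hsForm (tensorPow θ n) (1 - E) := hsForm_nonneg hA (sub_nonneg.2 hE1)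
  have h2 : 0 ≤ hsForm (iidMix μ n) E := hsForm_nonneg hn hE0
  refine ⟨E, hE0, hE1, ?_, ?_⟩
  · exact (le_add_of_nonneg_right (mul_nonneg (Real.exp_pos _).le h2)).trans hE
  · rw [Real.exp_neg, ← div_eq_mul_inv, le_div_iff₀ (Real.exp_pos _), mul_comm]
    exact (le_add_of_nonneg_left h1).trans hE


lemma exists_pos_weightedOverlap_lt {ρ : MatC ι} (hρ : 0 ≤ ρ) (μ : Measure ↥C) {a : ℝ} {k : ℕ}
    {x : ℝ} (h : weightedOverlap ρ μ a k m < x) :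
    ∃ η : ℝ, 0 < η ∧ weightedOverlap (ρ + algebraMap ℝ _ η) μ a k m < x := by
  have hθ : ∀ η : ℝ, 0 ≤ η → 0 ≤ ρ + algebraMap ℝ (MatC ι) η := fun η hη =>
    add_nonneg hρ (algebraMap_nonneg _ hη)
  have hc : Continuous fun η : ℝ => tensorPow (ρ + algebraMap ℝ (MatC ι) η) m := by
    refine continuous_matrix fun i j => continuous_finsetProd _ fun l _ => ?_
    exact (continuous_const.add (continuous_algebraMap ℝ (MatC ι))).matrix_elem _ _
  have hp : ContinuousOn
      (fun η : ℝ => tensorPow (ρ + algebraMap ℝ (MatC ι) η) m ^ ((k : ℝ≥0) / (k + 1)))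
      (Set.Ici 0) :=
    (CFC.continuousOn_nnrpow _).comp hc.continuousOn
      fun η hη => tensorPow_nonneg (hθ η hη) m
  have hL := ((hsForm (κ := Fin m → ι)).flip
    (iidMix μ m ^ ((1 : ℝ≥0) / (k + 1)))).continuous_of_finiteDimensional
  have hw : ContinuousOn (fun η : ℝ => weightedOverlap (ρ + algebraMap ℝ (MatC ι) η) μ a k m)
      (Set.Ici 0) := (hL.comp_continuousOn hp).const_smul (Real.exp (m * a / (k + 1)))
  have h0 := (hw 0 Set.self_mem_Ici).mono Set.Ioi_subset_Ici_self
  have h1 : ∀ᶠ η in 𝓝[>] (0 : ℝ), weightedOverlap (ρ + algebraMap ℝ (MatC ι) η) μ a k m < x :=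
    h0.eventually_lt_const (by simpa using h)
  obtain ⟨η, hη, hη0⟩ := (h1.and self_mem_nhdsWithin).exists
  exact ⟨η, hη0, hη⟩

lemma exists_local_test (hst : ∀ σ ∈ C, IsState σ) {μ : Measure ↥C} [IsProbabilityMeasure μ]
    (hμ : Universal μ) {ρ : MatC ι} (hρ : IsState ρ) {a r : ℝ} (har : a < r)
    (h : ∃ᶠ n in atTop, (r : EReal) < cFrac n * relEnt (tensorPow ρ n) (iidMix μ n)) :
    ∃ U ∈ 𝓝 ρ, ∀ ε : ℝ, 0 < ε → ∀ᶠ n in atTop, ∃ E : MatN ι n, 0 ≤ E ∧ E ≤ 1 ∧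
      (∀ ρ' ∈ U, IsState ρ' → hsForm (tensorPow ρ' n) (1 - E) ≤ ε) ∧
      hsForm (iidMix μ n) E ≤ ε * Real.exp (-(n * a)) := by
  obtain ⟨κ, hκ⟩ := hμ ((r - a) / 2) (by linarith)
  obtain ⟨m, hm, hm1, hm2⟩ := (h.and_eventually ((eventually_gt_atTop 0).and
    (tendsto_natCast_atTop_atTop.eventually_ge_atTop (κ / ((r - a) / 2))))).exists
  rw [lt_cFrac_mul_iff hm1] at hm
  rw [div_le_iff₀ (by linarith)] at hm2
  set y := κ + m * ((r - a) / 2)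
  have hb : ((m * a + y : ℝ) : EReal) < relEnt (tensorPow ρ m) (iidMix μ m) := by
    refine lt_of_le_of_lt (EReal.coe_le_coe_iff.2 ?_) hm
    simp only [y]
    linarith
  obtain ⟨k, hk, hlt⟩ := exists_exp_mul_hsForm_nnrpow_lt_one (isState_tensorPow hρ m)
    (isState_iidMix hst μ m) hb
  have hlt' : weightedOverlap ρ μ a k m < Real.exp (-(y / (k + 1))) := by
    rw [Real.exp_neg, ← one_div, lt_div_iff₀ (Real.exp_pos _)]
    refine lt_of_eq_of_lt ?_ hlt
    rw [add_div (m * a) y, Real.exp_add (m * a / (k + 1)), weightedOverlap]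
    exact mul_right_comm (Real.exp (m * a / (k + 1))) _ _
  obtain ⟨η, hη, hθlt⟩ := exists_pos_weightedOverlap_lt hρ.nonneg μ hlt'
  set θ := ρ + algebraMap ℝ (MatC ι) η
  have hθ : 0 ≤ θ := add_nonneg hρ.nonneg (algebraMap_nonneg _ hη.le)
  have hw0 : ∀ n, 0 ≤ weightedOverlap θ μ a k n := fun n =>
    mul_nonneg (Real.exp_pos _).le (hsForm_nnrpow_nonneg _ _ _ _)
  have hx : Real.exp (y / (k + 1)) * weightedOverlap θ μ a k m < 1 := by
    rwa [Real.exp_neg, ← one_div, lt_div_iff₀ (Real.exp_pos _), mul_comm] at hθlt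
  have hlim := tendsto_zero_of_le_mul hw0 (mul_nonneg (Real.exp_pos _).le (hw0 m)) hx hm1
    fun n => weightedOverlap_add_le hst μ hθ hk (hκ m)
  refine ⟨Metric.ball ρ η, Metric.ball_mem_nhds ρ hη, fun ε hε => ?_⟩
  filter_upwards [hlim.eventually_le_const hε] with n hn
  obtain ⟨E, hE0, hE1, hE2, hE3⟩ := exists_test_weightedOverlap hst μ hθ a hk n
  refine ⟨E, hE0, hE1, fun ρ' hρ' hst' => ?_, hE3.trans (by gcongr)⟩
  have hle : ρ' ≤ θ := by
    have hsa : IsSelfAdjoint (ρ' - ρ) := hst'.1.isHermitian.isSelfAdjoint.sub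
      hρ.1.isHermitian.isSelfAdjoint
    have h1 := hsa.le_algebraMap_norm_self
    have h2 : algebraMap ℝ (MatC ι) ‖ρ' - ρ‖ ≤ algebraMap ℝ (MatC ι) η :=
      algebraMap_mono _ (mem_ball_iff_norm.1 hρ').le
    exact sub_le_iff_le_add'.1 (h1.trans h2)
  have h3 := hsForm_mono_left (tensorPow_mono hst'.nonneg hle n) (sub_nonneg.2 hE1)
  exact h3.trans (hE2.trans hn)

end Decay

section Minimizer
open scoped MatrixOrder Matrix.Norms.L2Operator NNReal

variable {ι : Type*} [Fintype ι] [DecidableEq ι] {A1 C : Set (MatC ι)}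

/-- Around `ρ`, tests against the mixtures of `μ` achieve type II error decaying at rate `a`
uniformly on a neighbourhood. -/
def LocallyTestable (μ : Measure ↥C) (ρ : MatC ι) (a : ℝ) : Prop :=
  ∃ U ∈ 𝓝 ρ, ∀ ε : ℝ, 0 < ε → ∀ᶠ n in atTop, ∃ E : MatN ι n, 0 ≤ E ∧ E ≤ 1 ∧
    (∀ ρ' ∈ U, IsState ρ' → hsForm (tensorPow ρ' n) (1 - E) ≤ ε) ∧
    hsForm (iidMix μ n) E ≤ ε * Real.exp (-(n * a))

lemma isCompact_of_isState (hA : ∀ ρ ∈ A1, IsState ρ) (hcl : IsClosed A1) : IsCompact A1 := by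
  have := FiniteDimensional.proper ℝ (MatC ι)
  exact (isCompact_closedBall (0 : MatC ι) 1).of_isClosed_subset hcl fun ρ hρ => by
    simpa using (hA ρ hρ).norm_le_one

lemma exists_achievable_of_locallyTestable (hA : ∀ ρ ∈ A1, IsState ρ) (hcl : IsClosed A1)
    (hA_ne : A1.Nonempty) (hst : ∀ σ ∈ C, IsState σ) {μ : Measure ↥C} [IsProbabilityMeasure μ]
    (hμ : Universal μ) {s : EReal} (h : ∀ ρ ∈ A1, ∃ a : ℝ, s < a ∧ LocallyTestable μ ρ a) :
    ∃ r : ℝ, s < r ∧ Achievable (iidSet A1) (iidSet C) r := by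
  choose! a ha U hU htest using h
  obtain ⟨t, htA, hcov⟩ := (isCompact_of_isState hA hcl).elim_nhds_subcover U hU
  have ht_ne : t.Nonempty := by
    obtain ⟨ρ, hρ⟩ := hA_ne
    obtain ⟨j, hj, -⟩ := Set.mem_iUnion₂.1 (hcov hρ)
    exact ⟨j, hj⟩
  obtain ⟨j₀, hj₀, hmin⟩ := t.exists_min_image a ht_ne
  obtain ⟨r, hsr, hr⟩ := EReal.lt_iff_exists_real_btwn.1 (ha j₀ (htA j₀ hj₀))
  rw [EReal.coe_lt_coe_iff] at hr
  refine ⟨r, hsr, fun ε hε => ?_⟩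
  have hγ : 0 < (a j₀ - r) / 2 := by linarith
  set γ := (a j₀ - r) / 2
  have hη : 0 < ε / 2 := by linarith [hε.1]
  obtain ⟨κ, hκ⟩ := hμ γ hγ
  filter_upwards [(eventually_all_finset t).2 fun j hj => htest j (htA j hj) _ hη,
    eventually_mul_pow_le_exp (Real.exp κ * t.card) 0 hγ] with n hn hexp
  choose! E hE0 hE1 hEA hEB using hn
  obtain ⟨F, hF0, hF1, hFE, hFs⟩ := exists_union_test t E hE0 hE1 hη
  refine ⟨F, hF0, hF1, ?_, ?_⟩
  · rintro _ ⟨ρ, hρ, rfl⟩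
    obtain ⟨j, hj, hρj⟩ := Set.mem_iUnion₂.1 (hcov hρ)
    have hρn := isState_tensorPow (hA ρ hρ) n
    have h1 := hsForm_mono_right hρn.nonneg (hFE j hj)
    rw [map_add, Algebra.algebraMap_eq_smul_one, map_smul, hρn.hsForm_one, smul_eq_mul,
      mul_one] at h1
    linarith [hEA j hj ρ hρj (hA ρ hρ)]
  · rintro _ ⟨σ, hσ, rfl⟩
    have hω := (isState_iidMix hst μ n).nonneg
    have h1 := hsForm_mono_left (hκ n σ hσ) hF0
    rw [map_smul, LinearMap.smul_apply, smul_eq_mul] at h1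
    have h2 := hsForm_mono_right hω hFs
    rw [map_smul, map_sum, smul_eq_mul] at h2
    have h3 : ∑ j ∈ t, hsForm (iidMix μ n) (E j) ≤
        t.card * (ε / 2 * Real.exp (-(n * a j₀))) := by
      rw [← nsmul_eq_mul]
      refine Finset.sum_le_card_nsmul _ _ _ fun j hj => (hEB j hj).trans ?_
      gcongr
      exact hmin j hj
    calc hsForm (tensorPow σ n) F ≤ Real.exp (κ + n * γ) * hsForm (iidMix μ n) F := h1
      _ ≤ Real.exp (κ + n * γ) *
          ((ε / 2)⁻¹ * (t.card * (ε / 2 * Real.exp (-(n * a j₀))))) := by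
        gcongr
        exact h2.trans (by gcongr)
      _ = Real.exp κ * t.card * ((n : ℝ) + 1) ^ 0 *
          (Real.exp (n * γ) * Real.exp (-(n * a j₀))) := by
        rw [Real.exp_add, mul_left_comm (t.card : ℝ), inv_mul_cancel_left₀ hη.ne']; ring
      _ ≤ Real.exp (n * γ) * (Real.exp (n * γ) * Real.exp (-(n * a j₀))) := by gcongr
      _ = Real.exp (-(n * r)) := by
        rw [← Real.exp_add, ← Real.exp_add]; congr 1; simp only [γ]; ring

lemma exists_eventually_cFrac_mul_relEnt_le (hA : ∀ ρ ∈ A1, IsState ρ) (hcl : IsClosed A1)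
    (hA_ne : A1.Nonempty) (hst : ∀ σ ∈ C, IsState σ) (hne : C.Nonempty) {μ : Measure ↥C}
    [IsProbabilityMeasure μ] (hμ : Universal μ) :
    ∃ ρ ∈ A1, ∀ r : ℝ, steinExponent (iidSet A1) (iidSet C) < r →
      ∀ᶠ n in atTop, cFrac n * relEnt (tensorPow ρ n) (iidMix μ n) ≤ r := by
  by_contra! hcon
  obtain ⟨r, hr, hach⟩ := exists_achievable_of_locallyTestable hA hcl hA_ne hst hμ
    (s := steinExponent (iidSet A1) (iidSet C)) fun ρ hρ => by
      obtain ⟨r, hr, hfreq⟩ := hcon ρ hρ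
      obtain ⟨a, ha, har⟩ := EReal.lt_iff_exists_real_btwn.1 hr
      exact ⟨a, ha, exists_local_test hst hμ (hA ρ hρ) (EReal.coe_lt_coe_iff.1 har)
        (by simpa using hfreq)⟩
  exact (hach.le_steinExponent (isState_of_mem_iidSet hst) (iidSet_nonempty hne)).not_gt hr

end Minimizer

/-- **Composite i.i.d. null versus arbitrarily varying alternative.**
`Stein(𝒜₁^{iid}‖ℬ₁^{av}) = Stein(𝒜₁^{iid}‖co(ℬ₁)^{av}) = Stein(𝒜₁^{iid}‖co(ℬ₁)^{iid})
  = min*_{ρ∈𝒜₁, μ∈𝒫(co(ℬ₁))} lim_n (1/n) D(ρ^{⊗n}‖∫dμ(σ) σ^{⊗n})`. -/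
theorem composite_iid_vs_av (d : ℕ)
    (A1 B1 : Set (MatC (Fin d)))
    (hA_states : ∀ ρ ∈ A1, IsState ρ) (hA_ne : A1.Nonempty) (hA_closed : IsClosed A1)
    (hB_states : ∀ σ ∈ B1, IsState σ) (hB_ne : B1.Nonempty) (hB_closed : IsClosed B1) :
    ∃ S : EReal,
      steinExponent (iidSet A1) (avSet B1) = S ∧
      steinExponent (iidSet A1) (avSet (convexHull ℝ B1)) = S ∧
      steinExponent (iidSet A1) (iidSet (convexHull ℝ B1)) = S ∧
      (∃ ρ ∈ A1, ∃ μ : Measure ↥(convexHull ℝ B1), IsProbabilityMeasure μ ∧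
        Filter.Tendsto (fun n : ℕ => cFrac n * relEnt (tensorPow ρ n) (iidMix μ n))
          Filter.atTop (nhds S)) ∧
      (∀ ρ ∈ A1, ∀ μ : Measure ↥(convexHull ℝ B1), IsProbabilityMeasure μ → ∀ L : EReal,
        Filter.Tendsto (fun n : ℕ => cFrac n * relEnt (tensorPow ρ n) (iidMix μ n))
          Filter.atTop (nhds L) → S ≤ L) := by
  have hC := isState_of_mem_convexHull hB_states
  have hCne : (convexHull ℝ B1).Nonempty := hB_ne.convexHull
  have hCc := convex_convexHull ℝ B1
  have hlow := fun (ρ : MatC (Fin d)) (hρ : ρ ∈ A1) (μ : Measure ↥(convexHull ℝ B1))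
    (_ : IsProbabilityMeasure μ) (r : ℝ)
    (hr : (r : EReal) < steinExponent (iidSet A1) (iidSet (convexHull ℝ B1))) =>
    eventually_le_cFrac_mul_relEnt hA_states hC hr hρ μ
  have hiid := steinExponent_iidSet_avSet (A1 := A1) hCc hC hCne
  refine ⟨steinExponent (iidSet A1) (iidSet (convexHull ℝ B1)), ?_, hiid.symm, rfl, ?_, ?_⟩
  · rw [hiid, steinExponent_avSet_convexHull hB_states hB_ne]
  · obtain ⟨μ, hμ, huniv⟩ := exists_universal hCc hCne hC
    obtain ⟨ρ, hρ, hup⟩ := exists_eventually_cFrac_mul_relEnt_le hA_states hA_closed hA_ne hC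
      hCne huniv
    refine ⟨ρ, hρ, μ, hμ, tendsto_order.2 ⟨fun b hb => ?_, fun b hb => ?_⟩⟩
    · obtain ⟨r, hbr, hr⟩ := EReal.lt_iff_exists_real_btwn.1 hb
      exact (hlow ρ hρ μ hμ r hr).mono fun n hn => hbr.trans_le hn
    · obtain ⟨r, hr, hrb⟩ := EReal.lt_iff_exists_real_btwn.1 hb
      exact (hup r hr).mono fun n hn => hn.trans_lt hrb
  · intro ρ hρ μ hμ L hL
    exact EReal.ge_of_forall_gt_iff_ge.1 fun z hz => ge_of_tendsto hL (hlow ρ hρ μ hμ z hz)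

end QSanov
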